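/- arXiv:2407.19878 — 5 statements merged into one kernel-verified Lean document; each statement's English description precedes it below -/
import Mathlib

section
/- Let {G_n} be a sequence of finite groups and, for each n, let ν_n and μ_n be probability measures on G_n. Assume: (i) there are sequences τ_{ν,n} → ∞ and w_{ν,n} = o(τ_{ν,n}) such that lim_{c→−∞} liminf_n ‖ν_n^{*⌈τ_{ν,n}+c·w_{ν,n}⌉} − U_{G_n}‖_TV = 1 and lim_{c→∞} limsup_n ‖ν_n^{*⌈τ_{ν,n}+c·w_{ν,n}⌉} − U_{G_n}‖_TV = 0 (cutoff), and for every c ∈ ℝ the limit f(c) := lim_n ‖ν_n^{*⌈τ_{ν,n}+c·w_{ν,n}⌉} − U_{G_n}‖_TV exists; (ii) there are real sequences τ_{μ,n} and w_{μ,n} with w_{μ,n} = o(τ_{μ,n}) such that for every c ∈ ℝ, lim_{n→∞} |G_n| · Σ_{g∈G_n} ( ν_n^{*⌈τ_{ν,n}+c·w_{ν,n}⌉}(g) − μ_n^{*⌈τ_{μ,n}+c·w_{μ,n}⌉}(g) )² = 0. Then for every c ∈ ℝ, lim_{n→∞} ‖μ_n^{*⌈τ_{μ,n}+c·w_{μ,n}⌉}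 − U_{G_n}‖_TV = f(c); in particular lim_{c→−∞} liminf_n ‖μ_n^{*⌈τ_{μ,n}+c·w_{μ,n}⌉} − U_{G_n}‖_TV = 1 and lim_{c→∞} limsup_n ‖μ_n^{*⌈τ_{μ,n}+c·w_{μ,n}⌉} − U_{G_n}‖_TV = 0, so the μ_n-walk exhibits cutoff at time τ_{μ,n} with window w_{μ,n} and has limit profile f. -/
open scoped Classical
open Filter

noncomputable def convolve {G : Type*} [Group G] [Fintype G] (α β : G → ℝ) : G → ℝ :=
  fun x => ∑ g : G, α g * β (g⁻¹ * x)

noncomputable def convPow {G : Type*} [Group G] [Fintype G] (γ : G → ℝ) : ℕ → G → ℝ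
  | 0 => fun x => if x = 1 then 1 else 0
  | k + 1 => convolve (convPow γ k) γ

noncomputable def tvDist {Ω : Type*} [Fintype Ω] (p q : Ω → ℝ) : ℝ :=
  (∑ ω : Ω, |p ω - q ω|) / 2

noncomputable def unif (Ω : Type*) [Fintype Ω] : Ω → ℝ := fun _ => 1 / (Fintype.card Ω)



theorem tvDist_diff_le {Ω : Type*} [Fintype Ω] (p q u : Ω → ℝ) :
    |tvDist q u - tvDist p u| ≤
      Real.sqrt ((Fintype.card Ω : ℝ) * ∑ g : Ω, (p g - q g) ^ 2) := by
  have h1 : |tvDist q u - tvDist p u| ≤ ∑ g : Ω, |p g - q g| := by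
    have h2 : tvDist q u - tvDist p u = (∑ g : Ω, (|q g - u g| - |p g - u g|)) / 2 := by
      unfold tvDist
      rw [Finset.sum_sub_distrib]
      ring
    have h3 : |∑ g : Ω, (|q g - u g| - |p g - u g|)| ≤ ∑ g : Ω, |p g - q g| := by
      refine (Finset.abs_sum_le_sum_abs _ _).trans (Finset.sum_le_sum fun g _ => ?_)
      refine (abs_abs_sub_abs_le_abs_sub _ _).trans (le_of_eq ?_)
      rw [abs_sub_comm]
      congr 1
      ring
    rw [h2, abs_div, abs_two]
    have := abs_nonneg (∑ g : Ω, (|q g - u g| - |p g - u g|))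
    linarith
  refine h1.trans (Real.le_sqrt_of_sq_le ?_)
  have h4 := sq_sum_le_card_mul_sum_sq (s := (Finset.univ : Finset Ω)) (f := fun g => |p g - q g|)
  simpa [sq_abs] using h4

theorem comparison_of_limit_profiles
    (G : ℕ → Type*) [∀ n, Group (G n)] [∀ n, Fintype (G n)]
    (ν μ : ∀ n, G n → ℝ)
    (hν_nonneg : ∀ n, ∀ g, 0 ≤ ν n g) (hν_sum : ∀ n, ∑ g : G n, ν n g = 1)
    (hμ_nonneg : ∀ n, ∀ g, 0 ≤ μ n g) (hμ_sum : ∀ n, ∑ g : G n, μ n g = 1)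
    (τν wν τμ wμ : ℕ → ℝ)
    (hτν : Filter.Tendsto τν Filter.atTop Filter.atTop)
    (hwν : wν =o[Filter.atTop] τν)
    (hwμ : wμ =o[Filter.atTop] τμ)
    (f : ℝ → ℝ)
    (hcutoff_lo : Filter.Tendsto (fun c : ℝ =>
        Filter.liminf (fun n : ℕ =>
          tvDist (convPow (ν n) ⌈τν n + c * wν n⌉₊) (unif (G n))) Filter.atTop)
      Filter.atBot (nhds 1))
    (hcutoff_hi : Filter.Tendsto (fun c : ℝ =>
        Filter.limsup (fun n : ℕ =>
          tvDist (convPow (ν n) ⌈τν n + c * wν n⌉₊) (unif (G n))) Filter.atTop)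
      Filter.atTop (nhds 0))
    (hlimit : ∀ c : ℝ, Filter.Tendsto (fun n : ℕ =>
        tvDist (convPow (ν n) ⌈τν n + c * wν n⌉₊) (unif (G n)))
      Filter.atTop (nhds (f c)))
    (hcomp : ∀ c : ℝ, Filter.Tendsto (fun n : ℕ =>
        (Fintype.card (G n) : ℝ) *
          ∑ g : G n, (convPow (ν n) ⌈τν n + c * wν n⌉₊ g -
            convPow (μ n) ⌈τμ n + c * wμ n⌉₊ g) ^ 2)
      Filter.atTop (nhds 0)) :
    (∀ c : ℝ, Filter.Tendsto (fun n : ℕ =>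
        tvDist (convPow (μ n) ⌈τμ n + c * wμ n⌉₊) (unif (G n)))
      Filter.atTop (nhds (f c))) ∧
    Filter.Tendsto (fun c : ℝ =>
        Filter.liminf (fun n : ℕ =>
          tvDist (convPow (μ n) ⌈τμ n + c * wμ n⌉₊) (unif (G n))) Filter.atTop)
      Filter.atBot (nhds 1) ∧
    Filter.Tendsto (fun c : ℝ =>
        Filter.limsup (fun n : ℕ =>
          tvDist (convPow (μ n) ⌈τμ n + c * wμ n⌉₊) (unif (G n))) Filter.atTop)
      Filter.atTop (nhds 0) := by
  have key : ∀ c : ℝ, Filter.Tendsto (fun n : ℕ =>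
        tvDist (convPow (μ n) ⌈τμ n + c * wμ n⌉₊) (unif (G n)))
      Filter.atTop (nhds (f c)) := by
    intro c
    have h0 := (hcomp c).sqrt
    rw [Real.sqrt_zero] at h0
    have hd := squeeze_zero_norm (f := fun n : ℕ => tvDist (convPow (μ n) ⌈τμ n + c * wμ n⌉₊) (unif (G n)) -
      tvDist (convPow (ν n) ⌈τν n + c * wν n⌉₊) (unif (G n))) (fun n => tvDist_diff_le
      (convPow (ν n) ⌈τν n + c * wν n⌉₊) (convPow (μ n) ⌈τμ n + c * wμ n⌉₊) (unif (G n))) h0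
    simpa using hd.add (hlimit c)
  refine ⟨key, ?_, ?_⟩
  · refine hcutoff_lo.congr fun c => ?_
    rw [(hlimit c).liminf_eq, (key c).liminf_eq]
  · refine hcutoff_hi.congr fun c => ?_
    rw [(hlimit c).limsup_eq, (key c).limsup_eq]
end

section
/- For every real number c, lim_{n→∞} (n!/2) · Σ_{σ∈A_n} ( Q^{*⌈(n/3)(log n + c)⌉}(σ) − P^{*⌈(n−3/2)(log n + c)⌉}(σ) )² = 0; that is, the distributions of the random walk generated by all 3-cycles after ⌈(n/3)(log n + c)⌉ steps and of the transpose top-2 with random shuffle after ⌈(n−3/2)(log n + c)⌉ steps become asymptotically indistinguishable in the scaled ℓ² sense. -/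
open scoped Classical
open Filter

/-- The transpose top-2 with random shuffle measure on `A_n`: mass `1/(2n-3)` on the
identity and on each 3-cycle of the form `(i, n-1, n)` or `(i, n, n-1)` with
`1 ≤ i ≤ n-2`; these 3-cycles are exactly the 3-cycles whose support contains both
of the two largest points. -/
noncomputable def Pmeas (n : ℕ) : alternatingGroup (Fin n) → ℝ := fun π =>
  if (π : Equiv.Perm (Fin n)) = 1 then 1 / (2 * (n : ℝ) - 3)
  else if (π : Equiv.Perm (Fin n)).IsThreeCycle ∧
      (∀ x : Fin n, n - 2 ≤ (x : ℕ) → x ∈ (π : Equiv.Perm (Fin n)).support) then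
    1 / (2 * (n : ℝ) - 3)
  else 0

/-- The measure `P'` on `A_n`: mass `1/(n-1)` on the identity and `1/(n-1)^2` on each
3-cycle of the form `(i,j,n)` or `(j,i,n)` with `1 ≤ i < j ≤ n-1`; these are exactly
the 3-cycles whose support contains the largest point. -/
noncomputable def P'meas (n : ℕ) : alternatingGroup (Fin n) → ℝ := fun π =>
  if (π : Equiv.Perm (Fin n)) = 1 then 1 / ((n : ℝ) - 1)
  else if (π : Equiv.Perm (Fin n)).IsThreeCycle ∧
      (∀ x : Fin n, (x : ℕ) = n - 1 → x ∈ (π : Equiv.Perm (Fin n)).support) then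
    1 / ((n : ℝ) - 1) ^ 2
  else 0

/-- The measure `Q` on `A_n` giving mass `3/(n(n-1)(n-2))` to every 3-cycle. -/
noncomputable def Qmeas (n : ℕ) : alternatingGroup (Fin n) → ℝ := fun π =>
  if (π : Equiv.Perm (Fin n)).IsThreeCycle then
    3 / ((n : ℝ) * ((n : ℝ) - 1) * ((n : ℝ) - 2))
  else 0


section LinAlg
variable {V : Type*} [NormedAddCommGroup V] [InnerProductSpace ℝ V] [FiniteDimensional ℝ V]

/-- `a` is an eigenvalue of `T` with an eigenvector in `U`. -/
def EigIn (U : Submodule ℝ V) (T : V →ₗ[ℝ] V) (a : ℝ) : Prop := ∃ v ∈ U, v ≠ 0 ∧ T v = a • v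

theorem spectral_norm_le (U : Submodule ℝ V) (T : V →ₗ[ℝ] V) (hT : T.IsSymmetric)
    (hU : ∀ v ∈ U, T v ∈ U) (k : ℕ) (t B : ℝ) (hB : 0 ≤ B)
    (h : ∀ a, EigIn U T a → |a ^ k - t| ≤ B) (u : V) (hu : u ∈ U) :
    ‖(T ^ k) u - t • u‖ ≤ B * ‖u‖ := by
  set S := T.restrict hU with hS
  have hSs : S.IsSymmetric := hT.restrict_invariant hU
  set b := hSs.eigenvectorBasis (n := Module.finrank ℝ U) rfl with hb
  set ev := hSs.eigenvalues (n := Module.finrank ℝ U) rfl with hev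
  have hSb : ∀ i, S (b i) = ev i • b i := fun i => by
    exact hSs.apply_eigenvectorBasis rfl i
  have hTb : ∀ i, T (b i : V) = ev i • (b i : V) := fun i => by
    have := congrArg (Subtype.val) (hSb i)
    simpa [hS] using this
  have hTk : ∀ i, (T ^ k) (b i : V) = (ev i ^ k) • (b i : V) := by
    intro i
    induction k generalizing t with
    | zero => simp
    | succ k ih =>
      have ih' : (T ^ k) (b i : V) = (ev i ^ k) • (b i : V) := by
        clear ih h
        induction k with
        | zero => simp
        | succ k ih => rw [pow_succ', Module.End.mul_apply, ih, map_smul, hTb, smul_smul, pow_succ]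
      rw [pow_succ', Module.End.mul_apply, ih', map_smul, hTb, smul_smul, pow_succ]
  have hbd : ∀ i, |ev i ^ k - t| ≤ B := fun i => by
    refine h _ ⟨b i, (b i).2, ?_, hTb i⟩
    have := b.orthonormal.ne_zero i
    simpa using this
  set c := b.repr ⟨u, hu⟩ with hc
  have hu' : u = ∑ i, c i • (b i : V) := by
    have := congrArg Subtype.val (b.sum_repr ⟨u, hu⟩)
    simpa using this.symm
  have e1 : (T ^ k) u - t • u = ((∑ i, (c i * (ev i ^ k - t)) • b i : U) : V) := by
    conv_lhs => rw [hu']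
    simp only [map_sum, map_smul, hTk, Finset.smul_sum, ← Finset.sum_sub_distrib,
      Submodule.coe_sum, Submodule.coe_smul]
    refine Finset.sum_congr rfl fun i _ => ?_
    rw [smul_smul, smul_smul, ← sub_smul]; congr 1; ring
  have norms : ∀ d : Fin (Module.finrank ℝ U) → ℝ, ‖(∑ i, d i • b i : U)‖ ^ 2 = ∑ i, (d i) ^ 2 := by
    intro d
    have := b.sum_sq_norm_inner_right (∑ i, d i • b i : U)
    rw [← this]
    refine Finset.sum_congr rfl fun i _ => ?_
    rw [b.orthonormal.inner_right_fintype]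
    simp
  have e2 : ‖u‖ ^ 2 = ∑ i, (c i) ^ 2 := by
    rw [← norms, b.sum_repr]; rfl
  rw [e1]
  refine le_of_sq_le_sq ?_ (by positivity) |>.trans le_rfl
  rw [← Submodule.coe_norm, norms, mul_pow, e2, Finset.mul_sum]
  refine Finset.sum_le_sum fun i _ => ?_
  rw [mul_pow, mul_comm]
  refine mul_le_mul_of_nonneg_right ?_ (sq_nonneg _)
  rw [← sq_abs]
  exact pow_le_pow_left₀ (abs_nonneg _) (hbd i) 2

theorem exists_eigIn (U : Submodule ℝ V) (T : V →ₗ[ℝ] V) (hT : T.IsSymmetric)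
    (hU : ∀ v ∈ U, T v ∈ U) (v : V) (hv : v ∈ U) (hv0 : v ≠ 0) : ∃ a, EigIn U T a := by
  by_contra hne
  push Not at hne
  have := spectral_norm_le U T hT hU 0 0 0 le_rfl (fun a ha => absurd ha (hne a)) v hv
  simp at this
  exact hv0 this

theorem joint_eig (U : Submodule ℝ V) (T S : V →ₗ[ℝ] V) (hS : S.IsSymmetric)
    (hU : ∀ v ∈ U, S v ∈ U) (hc : ∀ v, T (S v) = S (T v)) (a : ℝ) (h : EigIn U T a) :
    ∃ v ∈ U, v ≠ 0 ∧ T v = a • v ∧ ∃ b : ℝ, S v = b • v := by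
  obtain ⟨v, hv, hv0, hTv⟩ := h
  obtain ⟨b, w, hw, hw0, hSw⟩ := exists_eigIn (U ⊓ LinearMap.ker (T - a • LinearMap.id)) S hS
    (fun v hv => ⟨hU v hv.1, by
      have := hv.2
      simp only [SetLike.mem_coe, LinearMap.mem_ker, LinearMap.sub_apply, LinearMap.smul_apply,
        LinearMap.id_apply, sub_eq_zero] at this ⊢
      rw [hc, this, map_smul]⟩) v ⟨hv, by simp [hTv]⟩ hv0
  refine ⟨w, hw.1, hw0, ?_, b, hSw⟩
  have := hw.2
  simpa [sub_eq_zero] using this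

theorem sum_norm_proj {ι : Type*} [Fintype ι] (e : OrthonormalBasis ι ℝ V) (U : Submodule ℝ V) :
    ∑ i, ‖U.starProjection (e i)‖ ^ 2 = Module.finrank ℝ U := by
  have h1 := LinearMap.trace_eq_sum_inner (U.starProjection : V →ₗ[ℝ] V) e
  have h2 : LinearMap.IsProj U (U.starProjection : V →ₗ[ℝ] V) :=
    ⟨fun x => U.starProjection_apply_mem x, fun x hx => Submodule.starProjection_eq_self_iff.2 hx⟩
  rw [h2.trace] at h1
  rw [h1]
  refine Finset.sum_congr rfl fun i _ => ?_
  rw [← real_inner_self_eq_norm_sq]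
  rw [Submodule.inner_starProjection_left_eq_right]
  congr 1
  exact Submodule.starProjection_eq_self_iff.2 (U.starProjection_apply_mem _)

theorem finrank_le_of_orth (Z I Y : Submodule ℝ V) (h1 : Z ≤ I ⊔ Y) (h2 : Z ≤ Iᗮ) :
    Module.finrank ℝ Z ≤ Module.finrank ℝ Y := by
  have h3 : Z ⊓ I = ⊥ := by
    rw [eq_bot_iff]
    intro x hx
    have := h2 hx.1 x hx.2
    simpa using this
  have h4 := Submodule.finrank_sup_add_finrank_inf_eq Z I
  rw [h3, finrank_bot] at h4
  have h5 : Module.finrank ℝ (Z ⊔ I : Submodule ℝ V) ≤ Module.finrank ℝ (I ⊔ Y : Submodule ℝ V) :=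
    Submodule.finrank_mono (sup_le h1 le_sup_left)
  have h6 := Submodule.finrank_add_le_finrank_add_finrank I Y
  omega

theorem proj_sub (A B : Submodule ℝ V) (h : A ≤ B) (x : V) :
    B.starProjection x = A.starProjection x + (B ⊓ Aᗮ).starProjection x := by
  have h1 : (B ⊓ Aᗮ).starProjection x = B.starProjection x - A.starProjection x := by
    apply Submodule.eq_starProjection_of_mem_orthogonal
    · refine ⟨B.sub_mem (B.starProjection_apply_mem x) (h (A.starProjection_apply_mem x)), ?_⟩
      have e : B.starProjection x - A.starProjection x
          = (x - A.starProjection x) - (x - B.starProjection x) := by abel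
      rw [e]
      exact Aᗮ.sub_mem (A.sub_starProjection_mem_orthogonal x)
        (Submodule.orthogonal_le h (B.sub_starProjection_mem_orthogonal x))
    · have e : x - (B.starProjection x - A.starProjection x)
          = (x - B.starProjection x) + A.starProjection x := by abel
      rw [e]
      refine Submodule.add_mem _ (Submodule.orthogonal_le inf_le_left (B.sub_starProjection_mem_orthogonal x)) ?_
      refine Submodule.orthogonal_le inf_le_right ?_
      exact Submodule.le_orthogonal_orthogonal _ (A.starProjection_apply_mem x)
  rw [h1]; abel

/-- Hilbert-Schmidt decomposition along a filtration. -/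
theorem hs_filtration (I : ℕ → Submodule ℝ V) (hI : Monotone I) (h0 : I 0 = ⊥) (T : V →ₗ[ℝ] V)
    (hT : ∀ j, ∀ v ∈ I j, T v ∈ I j) (hT' : ∀ j, ∀ v ∈ (I j)ᗮ, T v ∈ (I j)ᗮ) (N : ℕ) (x : V) :
    ‖T ((I N).starProjection x)‖ ^ 2 =
      ∑ j ∈ Finset.range N, ‖T ((I (j + 1) ⊓ (I j)ᗮ).starProjection x)‖ ^ 2 := by
  induction N with
  | zero => simp [h0]
  | succ N ih =>
    rw [Finset.sum_range_succ, ← ih, proj_sub (I N) (I (N + 1)) (hI (Nat.le_succ N)) x, map_add]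
    rw [@norm_add_sq_real]
    have : inner ℝ (T ((I N).starProjection x)) (T ((I (N + 1) ⊓ (I N)ᗮ).starProjection x)) = 0 := by
      refine hT' N _ ?_ _ (hT N _ ((I N).starProjection_apply_mem x))
      exact (Submodule.mem_inf.1 (Submodule.starProjection_apply_mem (I (N + 1) ⊓ (I N)ᗮ) x)).2
    rw [this]; ring

/-- bound of the HS sum on a subspace. -/
theorem hs_bound {ι : Type*} [Fintype ι] (e : OrthonormalBasis ι ℝ V) (U : Submodule ℝ V)
    (T : V →ₗ[ℝ] V) (B : ℝ) (h : ∀ u ∈ U, ‖T u‖ ^ 2 ≤ B * ‖u‖ ^ 2) :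
    ∑ i, ‖T (U.starProjection (e i))‖ ^ 2 ≤ B * Module.finrank ℝ U := by
  rw [← sum_norm_proj e U, Finset.mul_sum]
  exact Finset.sum_le_sum fun i _ => h _ (U.starProjection_apply_mem _)

theorem hs_bound_split {ι : Type*} [Fintype ι] (e : OrthonormalBasis ι ℝ V) (U K : Submodule ℝ V)
    (hK : K ≤ U) (T : V →ₗ[ℝ] V) (B₁ B₂ : ℝ) (h1 : ∀ u ∈ K, ‖T u‖ ^ 2 ≤ B₁ * ‖u‖ ^ 2)
    (h2 : ∀ u ∈ U, ‖T u‖ ^ 2 ≤ B₂ * ‖u‖ ^ 2) :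
    ∑ i, ‖T (U.starProjection (e i))‖ ^ 2 ≤ 2 * (B₁ * Module.finrank ℝ K) +
      2 * (B₂ * Module.finrank ℝ (U ⊓ Kᗮ : Submodule ℝ V)) := by
  have a1 := hs_bound e K T B₁ h1
  have a2 := hs_bound e (U ⊓ Kᗮ) T B₂ (fun u hu => h2 u hu.1)
  refine le_trans ?_ (add_le_add (mul_le_mul_of_nonneg_left a1 zero_le_two)
    (mul_le_mul_of_nonneg_left a2 zero_le_two))
  rw [Finset.mul_sum, Finset.mul_sum, ← Finset.sum_add_distrib]
  refine Finset.sum_le_sum fun i _ => ?_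
  rw [proj_sub K U hK, map_add]
  have := norm_add_le (T (K.starProjection (e i))) (T ((U ⊓ Kᗮ).starProjection (e i)))
  have h3 := pow_le_pow_left₀ (norm_nonneg _) this 2
  nlinarith [sq_nonneg (‖T (K.starProjection (e i))‖ - ‖T ((U ⊓ Kᗮ).starProjection (e i))‖)]

/-- dimension of the complement of the kernel inside `U`. -/
theorem finrank_compl_ker (U : Submodule ℝ V) (A : V →ₗ[ℝ] V) :
    Module.finrank ℝ (U ⊓ (U ⊓ LinearMap.ker A)ᗮ : Submodule ℝ V) = Module.finrank ℝ (U.map A) := by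
  have h1 := Submodule.finrank_add_inf_finrank_orthogonal (K₁ := U ⊓ LinearMap.ker A) (K₂ := U) inf_le_left
  have h2 := LinearMap.finrank_range_add_finrank_ker (A.domRestrict U)
  rw [LinearMap.range_domRestrict, LinearMap.ker_domRestrict] at h2
  have h3 : Module.finrank ℝ (Submodule.comap U.subtype (LinearMap.ker A)) =
      Module.finrank ℝ (U ⊓ LinearMap.ker A : Submodule ℝ V) := by
    have := Submodule.finrank_map_subtype_eq U (Submodule.comap U.subtype (LinearMap.ker A))
    rw [← this, Submodule.map_comap_subtype]
  change _ + Module.finrank ℝ (Submodule.comap U.subtype (LinearMap.ker A)) = _ at h2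
  rw [inf_comm U ((U ⊓ LinearMap.ker A)ᗮ)]
  omega

end LinAlg

section Swap
variable {V : Type*} [NormedAddCommGroup V] [InnerProductSpace ℝ V] [FiniteDimensional ℝ V]

theorem swap_core (U : Submodule ℝ V) (s J J' : V →ₗ[ℝ] V) (hs : ∀ v, s (s v) = v)
    (h1 : ∀ v, J (s v) = s (J' v) - v) (hJ : J.IsSymmetric) (hsU : ∀ v ∈ U, s v ∈ U)
    (v : V) (hv : v ∈ U) (hv0 : v ≠ 0) (a b : ℝ) (hb : J v = b • v) (ha : J' v = a • v) :
    a ≠ b ∧ ((s v = v ∧ b = a - 1) ∨ (s v = -v ∧ b = a + 1) ∨ EigIn U J a) := by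
  have hne : a ≠ b := by
    rintro rfl
    have h2 := hJ (s v) v
    rw [h1, ha, hb, map_smul, inner_sub_left, inner_smul_left, inner_smul_right] at h2
    simp at h2
    exact hv0 h2
  refine ⟨hne, ?_⟩
  have hd : a - b ≠ 0 := sub_ne_zero.2 hne
  set w := s v - (a - b)⁻¹ • v with hw
  by_cases hw0 : w = 0
  · have h3 : s v = (a - b)⁻¹ • v := sub_eq_zero.1 hw0
    have h4 : v = ((a - b)⁻¹ * (a - b)⁻¹) • v := by
      conv_lhs => rw [← hs v, h3, map_smul, h3, smul_smul]
    have h5 : (a - b)⁻¹ * (a - b)⁻¹ = 1 := by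
      have : ((a - b)⁻¹ * (a - b)⁻¹ - 1) • v = 0 := by rw [sub_smul, ← h4, one_smul, sub_self]
      rcases smul_eq_zero.1 this with h | h
      · linarith
      · exact absurd h hv0
    rcases mul_self_eq_one_iff.1 h5 with h | h
    · left
      refine ⟨by rw [h3, h, one_smul], ?_⟩
      have := inv_eq_one.1 h
      linarith
    · right; left
      refine ⟨by rw [h3, h, neg_one_smul], ?_⟩
      have : (a - b) = -1 := by
        rw [← inv_inv (a - b), h]; norm_num
      linarith
  · right; right
    refine ⟨w, U.sub_mem (hsU v hv) (U.smul_mem _ hv), hw0, ?_⟩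
    rw [hw, map_sub, h1, ha, map_smul, map_smul, hb, smul_sub, smul_smul, smul_smul]
    have : v = ((a - b)⁻¹ * (a - b)) • v := by rw [inv_mul_cancel₀ hd, one_smul]
    have e : (a * (a - b)⁻¹) = (a - b)⁻¹ * (a - b) + (a - b)⁻¹ * b := by ring
    rw [e, add_smul, ← this]
    abel

theorem spec_incl (U : Submodule ℝ V) (s J J' : V →ₗ[ℝ] V) (hs : ∀ v, s (s v) = v)
    (h1 : ∀ v, J (s v) = s (J' v) - v) (hJ : J.IsSymmetric) (hsU : ∀ v ∈ U, s v ∈ U)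
    (hJU : ∀ v ∈ U, J v ∈ U) (hc : ∀ v, J' (J v) = J (J' v)) (a : ℝ) (h : EigIn U J' a) :
    ∃ b, EigIn U J b ∧ (a = b ∨ a = b + 1 ∨ a = b - 1) := by
  obtain ⟨v, hv, hv0, hT, b, hb⟩ := joint_eig U J' J hJ hJU hc a h
  obtain ⟨-, h2 | h2 | h2⟩ := swap_core U s J J' hs h1 hJ hsU v hv hv0 a b hb hT
  · exact ⟨b, ⟨v, hv, hv0, hb⟩, by right; left; linarith [h2.2]⟩
  · exact ⟨b, ⟨v, hv, hv0, hb⟩, by right; right; linarith [h2.2]⟩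
  · exact ⟨a, h2, Or.inl rfl⟩

end Swap

section Rep
open Equiv

abbrev EE (n : ℕ) := EuclideanSpace ℝ (Perm (Fin n))

/-- right translation -/
noncomputable def RR (n : ℕ) : Perm (Fin n) →* Module.End ℝ (EE n) where
  toFun g :=
    { toFun := fun F => WithLp.toLp 2 (fun σ => F (σ * g))
      map_add' := fun x y => by ext; simp
      map_smul' := fun c x => by ext; simp }
  map_one' := by ext; simp
  map_mul' g h := by ext; simp [mul_assoc]

variable {n : ℕ}

@[simp] theorem RR_apply (g : Perm (Fin n)) (F : EE n) (σ : Perm (Fin n)) :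
    (RR n g F) σ = F (σ * g) := rfl

theorem RR_mul_apply (g h : Perm (Fin n)) (F : EE n) : RR n (g * h) F = RR n g (RR n h F) := by
  rw [map_mul]; rfl

theorem RR_inner (g : Perm (Fin n)) (x y : EE n) :
    inner ℝ (RR n g x) y = inner ℝ x (RR n g⁻¹ y) := by
  simp only [PiLp.inner_apply, RR_apply]
  exact Fintype.sum_equiv (Equiv.mulRight g) _ _ (fun σ => by simp)

/-- Jucys-Murphy operators -/
noncomputable def JM (k : Fin n) : Module.End ℝ (EE n) := ∑ i ∈ Finset.Iio k, RR n (swap i k)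

theorem JM_apply (k : Fin n) (v : EE n) : JM k v = ∑ i ∈ Finset.Iio k, RR n (swap i k) v := by
  simp [JM]

theorem JM_symm (k : Fin n) : (JM k).IsSymmetric := by
  intro x y
  rw [JM_apply, JM_apply, sum_inner, inner_sum]
  refine Finset.sum_congr rfl fun i _ => ?_
  rw [RR_inner, swap_inv]

theorem JM_comm_RR (k : Fin n) (g : Perm (Fin n)) (hk : g k = k) (hg : ∀ i, i < k ↔ g i < k)
    (v : EE n) : RR n g (JM k v) = JM k (RR n g v) := by
  rw [JM_apply, JM_apply, map_sum]
  refine Finset.sum_equiv g (by simpa using hg) ?_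
  intro i _
  rw [← RR_mul_apply, ← RR_mul_apply, Equiv.mul_swap_eq_swap_mul, hk]

theorem JM_comm_JM {k k' : Fin n} (h : k < k') (v : EE n) : JM k' (JM k v) = JM k (JM k' v) := by
  rw [JM_apply k, JM_apply k, map_sum]
  refine Finset.sum_congr rfl fun i hi => ?_
  have hi' : i < k := by simpa using hi
  symm
  apply JM_comm_RR
  · exact swap_apply_of_ne_of_ne (hi'.trans h).ne' h.ne'
  · intro x
    rcases eq_or_ne x i with rfl | h1
    · simp [h, hi'.trans h]
    · rcases eq_or_ne x k with rfl | h2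
      · simp [h, hi'.trans h]
      · rw [swap_apply_of_ne_of_ne h1 h2]

theorem RR_swap_swap (a b : Fin n) (v : EE n) : RR n (swap a b) (RR n (swap a b) v) = v := by
  rw [← RR_mul_apply, swap_mul_self, map_one]; rfl

theorem JM_swap {k k' : Fin n} (h : (k' : ℕ) = k + 1) (v : EE n) :
    JM k (RR n (swap k k') v) = RR n (swap k k') (JM k' v) - v := by
  have hI : Finset.Iio k' = insert k (Finset.Iio k) := by
    ext x; simp only [Finset.mem_Iio, Finset.mem_insert, Fin.lt_def, Fin.ext_iff]; omega
  have hkk : k < k' := by rw [Fin.lt_def]; omega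
  rw [JM_apply, JM_apply, hI, Finset.sum_insert (by simp), map_add, RR_swap_swap, add_sub_cancel_left,
    map_sum]
  refine Finset.sum_congr rfl fun i hi => ?_
  have hi' : i < k := by simpa using hi
  rw [← RR_mul_apply, ← RR_mul_apply, Equiv.mul_swap_eq_swap_mul (swap k k') i k']
  rw [swap_apply_right, swap_apply_of_ne_of_ne hi'.ne (hi'.trans hkk).ne]

/-- invariance under all right translations -/
def RInv (U : Submodule ℝ (EE n)) : Prop := ∀ g : Perm (Fin n), ∀ v ∈ U, RR n g v ∈ U

theorem RInv.JM {U : Submodule ℝ (EE n)} (h : RInv U) (k : Fin n) (v : EE n) (hv : v ∈ U) :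
    JM k v ∈ U := by
  rw [JM_apply]
  exact U.sum_mem fun i _ => h _ v hv

theorem JM_zero (k : Fin n) (hk : (k : ℕ) = 0) (v : EE n) : JM k v = 0 := by
  rw [JM_apply]
  have : Finset.Iio k = ∅ := by
    ext x; simp [Fin.lt_def, hk]
  rw [this]; simp

theorem JM_spec_incl {U : Submodule ℝ (EE n)} {k k' : Fin n} (h : (k' : ℕ) = k + 1)
    (hs : ∀ v ∈ U, RR n (swap k k') v ∈ U) (hJ : ∀ v ∈ U, JM k v ∈ U) (a : ℝ)
    (ha : EigIn U (JM k') a) :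
    ∃ b, EigIn U (JM k) b ∧ (a = b ∨ a = b + 1 ∨ a = b - 1) :=
  spec_incl U (RR n (swap k k')) (JM k) (JM k') (RR_swap_swap k k') (JM_swap h) (JM_symm k) hs hJ
    (JM_comm_JM (by rw [Fin.lt_def]; omega)) a ha

theorem JM_int {U : Submodule ℝ (EE n)} (hU : RInv U) (m : ℕ) : ∀ (k : Fin n), (k : ℕ) = m → ∀ (a : ℝ),
    EigIn U (JM k) a → ∃ z : ℤ, a = z ∧ |z| ≤ m := by
  induction m with
  | zero =>
    rintro k hk a ⟨v, hv, hv0, h⟩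
    rw [JM_zero k hk] at h
    rcases smul_eq_zero.1 h.symm with h | h
    · exact ⟨0, by simpa using h, by simp⟩
    · exact absurd h hv0
  | succ m ih =>
    intro k' hk' a ha
    have hm : m < n := by omega
    obtain ⟨b, hb, hab⟩ := JM_spec_incl (k := ⟨m, hm⟩) (k' := k') (by simpa using hk')
      (fun v hv => hU _ v hv) (fun v hv => hU.JM _ v hv) a ha
    obtain ⟨z, rfl, hz⟩ := ih ⟨m, hm⟩ rfl b hb
    rw [abs_le] at hz
    push_cast
    rcases hab with rfl | rfl | rfl
    · exact ⟨z, rfl, by rw [abs_le]; omega⟩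
    · exact ⟨z + 1, by push_cast; rfl, by rw [abs_le]; omega⟩
    · exact ⟨z - 1, by push_cast; rfl, by rw [abs_le]; omega⟩

/-- if some JM operator has eigenvalue `t ≥ 0` on `U` then `U` has, for some `k ≥ t`, a nonzero vector fixed
by all transpositions `(i k)`, `i < k`. -/
theorem exists_fixed {U : Submodule ℝ (EE n)} (hU : RInv U) (k₀ : Fin n) (t₀ : ℕ)
    (h : EigIn U (JM k₀) t₀) :
    ∃ k : Fin n, t₀ ≤ k ∧ ∃ v ∈ U, v ≠ 0 ∧ ∀ i < k, RR n (swap i k) v = v := by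
  have hbound : ∀ t : ℕ, (∃ k, EigIn U (JM k) (t : ℝ)) → t ≤ n := by
    rintro t ⟨k, hk⟩
    obtain ⟨z, hz, hz'⟩ := JM_int hU k k rfl _ hk
    have : z = t := by exact_mod_cast hz.symm
    rw [abs_le] at hz'
    omega
  set t := Nat.findGreatest (fun t => ∃ k, EigIn U (JM k) (t : ℝ)) n with ht
  have hex : ∃ k, EigIn U (JM k) (t₀ : ℝ) := ⟨k₀, h⟩
  have ht0 : t₀ ≤ t := Nat.le_findGreatest (hbound t₀ hex) hex
  have htt : ∃ k, EigIn U (JM k) (t : ℝ) :=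
    Nat.findGreatest_spec (P := fun t : ℕ => ∃ k, EigIn U (JM k) (t : ℝ)) (hbound t₀ hex) hex
  have hmax : ∀ k, ¬ EigIn U (JM k) ((t : ℝ) + 1) := by
    intro k hk
    have h2 : ∃ k, EigIn U (JM k) ((t + 1 : ℕ) : ℝ) := ⟨k, by push_cast; exact hk⟩
    have := Nat.le_findGreatest (P := fun t : ℕ => ∃ k, EigIn U (JM k) (t : ℝ)) (hbound _ h2) h2
    omega
  -- minimal k
  have hmin : ∃ m : ℕ, ∃ k : Fin n, (k : ℕ) = m ∧ EigIn U (JM k) (t : ℝ) := by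
    obtain ⟨k, hk⟩ := htt
    exact ⟨k, k, rfl, hk⟩
  obtain ⟨k, hkm, hk⟩ := Nat.find_spec hmin
  have hlt : ∀ k' : Fin n, k' < k → ¬ EigIn U (JM k') (t : ℝ) := by
    intro k' hk' hE
    exact Nat.find_min hmin (by rw [← hkm]; exact hk') ⟨k', rfl, hE⟩
  obtain ⟨v, hv, hv0, hJv⟩ := hk
  rcases Nat.eq_zero_or_pos (k : ℕ) with hk0 | hkpos
  · rw [JM_zero k hk0] at hJv
    rcases smul_eq_zero.1 hJv.symm with h | h
    · have : t = 0 := by exact_mod_cast h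
      exact ⟨k, by omega, v, hv, hv0, fun i hi => absurd hi (by rw [Fin.lt_def]; omega)⟩
    · exact absurd h hv0
  · obtain ⟨k1, hk1⟩ : ∃ k1 : Fin n, (k : ℕ) = k1 + 1 := ⟨⟨k - 1, by omega⟩, by simp; omega⟩
    have hk1k : k1 < k := by rw [Fin.lt_def]; omega
    set W : Submodule ℝ (EE n) := U ⊓ LinearMap.ker (JM k - (t : ℝ) • LinearMap.id) with hW
    have memW : ∀ w, w ∈ W ↔ w ∈ U ∧ JM k w = (t : ℝ) • w := by
      intro w; simp [hW, sub_eq_zero]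
    have key : ∀ w ∈ U, w ≠ 0 → JM k w = (t : ℝ) • w → ∀ b : ℝ, JM k1 w = b • w →
        RR n (swap k1 k) w = w ∧ b = t - 1 := by
      intro w hw hw0 hJ b hb
      obtain ⟨-, h2 | h2 | h2⟩ := swap_core U (RR n (swap k1 k)) (JM k1) (JM k)
        (RR_swap_swap _ _) (JM_swap hk1) (JM_symm _) (fun v hv => hU _ v hv) w hw hw0 t b hb hJ
      · exact h2
      · exact absurd ⟨w, hw, hw0, by rw [hb, h2.2]⟩ (hmax k1)
      · exact absurd h2 (hlt k1 hk1k)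
    have hWJ : ∀ w ∈ W, JM k1 w ∈ W := by
      intro w hw
      rw [memW] at hw ⊢
      exact ⟨hU.JM _ _ hw.1, by rw [JM_comm_JM hk1k, hw.2, map_smul]⟩
    have hscal : ∀ w ∈ W, JM k1 w = ((t : ℝ) - 1) • w := by
      intro w hw
      have := spectral_norm_le W (JM k1) (JM_symm k1) hWJ 1 ((t : ℝ) - 1) 0 le_rfl ?_ w hw
      · rw [pow_one, zero_mul] at this
        exact sub_eq_zero.1 (norm_le_zero_iff.1 this)
      · rintro a ⟨w, hw, hw0, ha⟩
        rw [memW] at hw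
        rw [(key w hw.1 hw0 hw.2 a ha).2]; simp
    have hfix : ∀ w ∈ W, RR n (swap k1 k) w = w := by
      intro w hw
      by_cases hw0 : w = 0
      · rw [hw0, map_zero]
      · have hw' := (memW w).1 hw
        exact (key w hw'.1 hw0 hw'.2 _ (hscal w hw)).1
    have hvW : v ∈ W := (memW v).2 ⟨hv, hJv⟩
    have hall : ∀ i < k, RR n (swap i k) v = v := by
      intro i hi
      rcases eq_or_ne i k1 with rfl | hik
      · exact hfix v hvW
      have hi1 : i < k1 := by
        rw [Fin.lt_def] at hi ⊢
        have : (i : ℕ) ≠ k1 := fun h => hik (Fin.ext h)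
        omega
      have hpi : RR n (swap i k1) v ∈ W := by
        rw [memW]
        refine ⟨hU _ _ hv, ?_⟩
        rw [← JM_comm_RR, hJv, map_smul]
        · exact swap_apply_of_ne_of_ne hi.ne' hk1k.ne'
        · intro x
          rcases eq_or_ne x i with rfl | h1
          · simp [hi, hk1k]
          · rcases eq_or_ne x k1 with rfl | h2
            · simp [hi, hk1k]
            · rw [swap_apply_of_ne_of_ne h1 h2]
      have h3 := congrArg (RR n (swap i k1)) (hfix _ hpi)
      have h6 : swap i k1 * swap k1 k * swap i k1 = swap i k := by
        rw [Equiv.mul_swap_eq_swap_mul (swap i k1) k1 k, swap_apply_right,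
          swap_apply_of_ne_of_ne hi.ne' hk1k.ne', mul_assoc, swap_mul_self, mul_one]
      rw [RR_swap_swap, ← RR_mul_apply, ← RR_mul_apply, h6] at h3
      exact h3
    refine ⟨k, ?_, v, hv, hv0, hall⟩
    have h4 : JM k v = (k : ℝ) • v := by
      rw [JM_apply, Finset.sum_congr rfl (fun i hi => hall i (by simpa using hi))]
      simp [Nat.cast_smul_eq_nsmul]
    rw [hJv] at h4
    have h5 : ((t : ℝ) - k) • v = 0 := by rw [sub_smul, h4, sub_self]
    rcases smul_eq_zero.1 h5 with h | h
    · have : (t : ℝ) = (k : ℕ) := by linarith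
      have : t = (k : ℕ) := by exact_mod_cast this
      omega
    · exact absurd h hv0

end Rep

section Filt
open Equiv
variable {n : ℕ}

/-- `1` or the sign character. -/
noncomputable def sg (ε : Bool) : Perm (Fin n) → ℝ := fun σ => if ε then ((Perm.sign σ : ℤ) : ℝ) else 1

theorem sg_mul (ε : Bool) (σ τ : Perm (Fin n)) : sg ε (σ * τ) = sg ε σ * sg ε τ := by
  unfold sg; split_ifs <;> simp

theorem sg_sq (ε : Bool) (σ : Perm (Fin n)) : sg ε σ * sg ε σ = 1 := by
  rw [← sg_mul]; unfold sg
  rcases Int.units_eq_one_or (Perm.sign σ) with h | h <;> simp [h]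

noncomputable def fA (A : Finset (Fin n)) (b : Fin n → Fin n) (ε : Bool) : EE n :=
  WithLp.toLp 2 (fun σ => sg ε σ * if ∀ x ∈ A, σ x = b x then 1 else 0)

theorem fA_apply (A : Finset (Fin n)) (b : Fin n → Fin n) (ε : Bool) (σ : Perm (Fin n)) :
    fA A b ε σ = sg ε σ * if ∀ x ∈ A, σ x = b x then 1 else 0 := rfl

theorem RR_fA (g : Perm (Fin n)) (A : Finset (Fin n)) (b : Fin n → Fin n) (ε : Bool) :
    RR n g (fA A b ε) = sg ε g • fA (A.image g) (b ∘ ⇑g⁻¹) ε := by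
  ext σ
  by_cases h : ∀ x ∈ A, σ (g x) = b x
  · have h' : ∀ x ∈ A.image g, σ x = (b ∘ ⇑g⁻¹) x := by
      intro x hx
      obtain ⟨y, hy, rfl⟩ := Finset.mem_image.1 hx
      simpa using h y hy
    have h'' : ∀ x ∈ A, (σ * g) x = b x := h
    simp only [RR_apply, WithLp.ofLp_smul, Pi.smul_apply, fA_apply, if_pos h', if_pos h'', sg_mul, smul_eq_mul]
    ring
  · have h' : ¬ ∀ x ∈ A.image g, σ x = (b ∘ ⇑g⁻¹) x := by
      intro h'; apply h; intro x hx
      simpa using h' (g x) (Finset.mem_image_of_mem _ hx)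
    have h'' : ¬ ∀ x ∈ A, (σ * g) x = b x := h
    simp only [RR_apply, WithLp.ofLp_smul, Pi.smul_apply, fA_apply, if_neg h', if_neg h'', sg_mul, smul_eq_mul]
    ring

noncomputable def II (n j : ℕ) : Submodule ℝ (EE n) :=
  Submodule.span ℝ {f | ∃ A b ε, A.card < j ∧ f = fA A b ε}

theorem II_mono : Monotone (II n) := by
  intro i j hij
  apply Submodule.span_mono
  rintro f ⟨A, b, ε, hA, rfl⟩
  exact ⟨A, b, ε, hA.trans_le hij, rfl⟩

theorem II_zero : II n 0 = ⊥ := by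
  rw [II, Submodule.span_eq_bot]
  rintro f ⟨A, b, ε, hA, rfl⟩
  exact absurd hA (by simp)

theorem fA_mem {j : ℕ} {A : Finset (Fin n)} (hA : A.card < j) (b : Fin n → Fin n) (ε : Bool) :
    fA A b ε ∈ II n j := Submodule.subset_span ⟨A, b, ε, hA, rfl⟩

theorem mem_II_orth {j : ℕ} {v : EE n} :
    v ∈ (II n j)ᗮ ↔ ∀ A b ε, A.card < j → inner ℝ (fA A b ε) v = 0 := by
  constructor
  · intro h A b ε hA
    exact h _ (fA_mem hA b ε)
  · intro h
    rw [Submodule.mem_orthogonal]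
    intro u hu
    induction hu using Submodule.span_induction with
    | mem x hx => obtain ⟨A, b, ε, hA, rfl⟩ := hx; exact h A b ε hA
    | zero => simp
    | add x y _ _ hx hy => rw [inner_add_left, hx, hy, add_zero]
    | smul c x _ hx => rw [inner_smul_left, hx, mul_zero]

theorem II_RInv (j : ℕ) : RInv (II n j) := by
  intro g v hv
  induction hv using Submodule.span_induction with
  | mem x hx =>
    obtain ⟨A, b, ε, hA, rfl⟩ := hx
    rw [RR_fA]
    exact Submodule.smul_mem _ _ (fA_mem (by rwa [Finset.card_image_of_injective _ g.injective]) _ _)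
  | zero => simp
  | add x y _ _ hx hy => rw [map_add]; exact Submodule.add_mem _ hx hy
  | smul c x _ hx => rw [map_smul]; exact Submodule.smul_mem _ _ hx

theorem RInv.orth {U : Submodule ℝ (EE n)} (h : RInv U) : RInv Uᗮ := by
  intro g v hv u hu
  rw [real_inner_comm, RR_inner, real_inner_comm]
  exact hv _ (h _ u hu)

theorem RInv.inf {U W : Submodule ℝ (EE n)} (h : RInv U) (h' : RInv W) : RInv (U ⊓ W) :=
  fun g v hv => ⟨h g v hv.1, h' g v hv.2⟩

theorem II_top : II n (n + 1) = ⊤ := by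
  rw [eq_top_iff]
  intro v _
  have : v = ∑ σ : Perm (Fin n), v σ • fA Finset.univ σ false := by
    ext τ
    simp only [WithLp.ofLp_sum, WithLp.ofLp_smul, Finset.sum_apply, Pi.smul_apply, fA_apply]
    rw [Finset.sum_eq_single τ]
    · simp [sg]
    · intro σ _ hσ
      rw [if_neg]
      · simp
      · intro h; exact hσ (Equiv.ext fun x => (h x (Finset.mem_univ x)).symm)
    · simp
  rw [this]
  exact Submodule.sum_mem _ fun σ _ => Submodule.smul_mem _ _ (fA_mem (by simp) _ _)

noncomputable def VV (n j : ℕ) : Submodule ℝ (EE n) := II n (j + 1) ⊓ (II n j)ᗮ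

theorem VV_RInv (j : ℕ) : RInv (VV n j) := (II_RInv _).inf (II_RInv _).orth

/-- multiplication by the sign -/
noncomputable def MM (n : ℕ) : Module.End ℝ (EE n) where
  toFun F := WithLp.toLp 2 (fun σ => sg true σ * F σ)
  map_add' x y := by ext; simp [mul_add]
  map_smul' c x := by ext; simp; ring

theorem MM_apply (F : EE n) (σ : Perm (Fin n)) : (MM n F) σ = sg true σ * F σ := rfl

theorem MM_MM (F : EE n) : MM n (MM n F) = F := by
  ext σ; rw [MM_apply, MM_apply, ← mul_assoc, sg_sq, one_mul]

theorem MM_inner (x y : EE n) : inner ℝ (MM n x) y = inner ℝ x (MM n y) := by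
  simp only [PiLp.inner_apply, MM_apply]
  refine Finset.sum_congr rfl fun i _ => ?_
  simp; ring

theorem MM_fA (A : Finset (Fin n)) (b : Fin n → Fin n) (ε : Bool) :
    MM n (fA A b ε) = fA A b (!ε) := by
  ext σ
  rw [MM_apply, fA_apply, fA_apply, ← mul_assoc]
  congr 1
  cases ε
  · simp [sg]
  · rw [sg_sq]; simp [sg]

theorem MM_RR (g : Perm (Fin n)) (v : EE n) : MM n (RR n g v) = sg true g • RR n g (MM n v) := by
  ext σ
  simp only [MM_apply, RR_apply, WithLp.ofLp_smul, Pi.smul_apply, sg_mul, smul_eq_mul]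
  have := sg_sq true g
  linear_combination -(sg true σ * v (σ * g)) * this

theorem II_MM (j : ℕ) (v : EE n) (hv : v ∈ II n j) : MM n v ∈ II n j := by
  induction hv using Submodule.span_induction with
  | mem x hx =>
    obtain ⟨A, b, ε, hA, rfl⟩ := hx
    rw [MM_fA]
    exact fA_mem hA _ _
  | zero => simp
  | add x y _ _ hx hy => rw [map_add]; exact Submodule.add_mem _ hx hy
  | smul c x _ hx => rw [map_smul]; exact Submodule.smul_mem _ _ hx

theorem VV_MM (j : ℕ) (v : EE n) (hv : v ∈ VV n j) : MM n v ∈ VV n j := by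
  refine ⟨II_MM _ _ hv.1, fun u hu => ?_⟩
  rw [← MM_inner]
  exact hv.2 _ (II_MM _ _ hu)

theorem MM_JM (k : Fin n) (v : EE n) : MM n (JM k v) = - JM k (MM n v) := by
  rw [JM_apply, JM_apply, map_sum, ← Finset.sum_neg_distrib]
  refine Finset.sum_congr rfl fun i hi => ?_
  have hi' : i < k := by simpa using hi
  rw [MM_RR, sg, if_pos rfl, Perm.sign_swap hi'.ne]
  simp

theorem EigIn_JM_neg (j : ℕ) (k : Fin n) (a : ℝ) (h : EigIn (VV n j) (JM k) a) :
    EigIn (VV n j) (JM k) (-a) := by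
  obtain ⟨v, hv, hv0, h⟩ := h
  refine ⟨MM n v, VV_MM _ _ hv, ?_, ?_⟩
  · intro h0
    apply hv0
    rw [← MM_MM v, h0, map_zero]
  · have := MM_JM k v
    rw [h, map_smul] at this
    rw [neg_smul, this, neg_neg]

/-- invariant vectors are detected by `fA`. -/
theorem fixed_eq_zero {j : ℕ} (A : Finset (Fin n)) (hA : A.card < j) (v : EE n) (hv : v ∈ (II n j)ᗮ)
    (hfix : ∀ g : Perm (Fin n), (∀ x ∈ A, g x = x) → RR n g v = v) : v = 0 := by
  ext σ₀
  have h1 := mem_II_orth.1 hv A σ₀ false hA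
  have h2 : inner ℝ (fA A σ₀ false) v
      = ∑ σ : Perm (Fin n), (if ∀ x ∈ A, σ x = σ₀ x then (1 : ℝ) else 0) * v σ₀ := by
    rw [PiLp.inner_apply]
    refine Finset.sum_congr rfl fun σ _ => ?_
    rw [fA_apply]
    split_ifs with h
    · have h3 := hfix (σ₀⁻¹ * σ) (fun x hx => by simp [h x hx])
      have h4 : v σ = v σ₀ := by
        conv_rhs => rw [← h3]
        simp
      simp [h4, sg]
    · simp
  rw [h2, ← Finset.sum_mul] at h1
  rcases mul_eq_zero.1 h1 with h | h
  · exfalso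
    have h5 : (0 : ℝ) < ∑ σ : Perm (Fin n), (if ∀ x ∈ A, σ x = σ₀ x then (1 : ℝ) else 0) := by
      refine Finset.sum_pos' (fun _ _ => by split_ifs <;> norm_num) ⟨σ₀, Finset.mem_univ _, by simp⟩
    linarith
  · simpa using h

theorem fixed_of_swaps (k : Fin n) (v : EE n) (h : ∀ i < k, RR n (swap i k) v = v) (N : ℕ) :
    ∀ g : Perm (Fin n), g.support.card ≤ N → (∀ x, k < x → g x = x) → RR n g v = v := by
  have hk : ∀ i, i ≤ k → RR n (swap i k) v = v := by
    intro i hi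
    rcases hi.eq_or_lt with rfl | hi
    · rw [swap_self, ← Perm.one_def, map_one]; rfl
    · exact h i hi
  have hswap : ∀ i j, i ≤ k → j ≤ k → RR n (swap i j) v = v := by
    intro i j hi hj
    rcases eq_or_ne i j with rfl | hij
    · rw [swap_self, ← Perm.one_def, map_one]; rfl
    rcases eq_or_ne j k with rfl | hjk
    · exact hk i hi
    have e : swap i j = swap i k * swap j k * swap i k := by
      rw [Equiv.mul_swap_eq_swap_mul (swap i k) j k, swap_apply_right,
        swap_apply_of_ne_of_ne hij.symm hjk, mul_assoc, swap_mul_self, mul_one, swap_comm]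
    rw [e, RR_mul_apply, RR_mul_apply, hk i hi, hk j hj, hk i hi]
  induction N with
  | zero =>
    intro g hg _
    have : g = 1 := by
      rw [← Perm.support_eq_empty_iff, ← Finset.card_eq_zero]; omega
    rw [this, map_one]; rfl
  | succ N ih =>
    intro g hg hfix
    by_cases h1 : g = 1
    · rw [h1, map_one]; rfl
    obtain ⟨x, hx⟩ : ∃ x, g x ≠ x := by
      by_contra hc; push Not at hc; exact h1 (Equiv.ext hc)
    have hxk : x ≤ k := by
      by_contra hc; exact hx (hfix x (not_le.1 hc))
    have hgxk : g x ≤ k := by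
      by_contra hc
      have := hfix (g x) (not_le.1 hc)
      exact hx (g.injective this)
    have h2 := Perm.card_support_swap_mul hx
    have h3 := ih (swap x (g x) * g) (by omega) (by
      intro y hy
      rw [Perm.mul_apply, hfix y hy, swap_apply_of_ne_of_ne (hxk.trans_lt hy).ne' (hgxk.trans_lt hy).ne'])
    have h4 : g = swap x (g x) * (swap x (g x) * g) := by rw [← mul_assoc, swap_mul_self, one_mul]
    rw [h4, RR_mul_apply, h3, hswap _ _ hxk hgxk]

theorem JM_bound_nat (j : ℕ) (k : Fin n) (t : ℕ) (h : EigIn (VV n j) (JM k) t) : t + 1 + j ≤ n := by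
  obtain ⟨k', hk', v, hv, hv0, hfix⟩ := exists_fixed (VV_RInv j) k t h
  by_contra hc
  apply hv0
  refine fixed_eq_zero (Finset.Ioi k') (j := j) ?_ v hv.2 ?_
  · rw [Fin.card_Ioi]; omega
  · intro g hg
    exact fixed_of_swaps k' v hfix _ g le_rfl (fun x hx => hg x (by simpa using hx))

theorem JM_bound (j : ℕ) (k : Fin n) (a : ℝ) (h : EigIn (VV n j) (JM k) a) :
    ∃ z : ℤ, a = z ∧ |z| + 1 + j ≤ n := by
  obtain ⟨z, rfl, -⟩ := JM_int (VV_RInv j) k k rfl a h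
  refine ⟨z, rfl, ?_⟩
  rcases le_total 0 z with hz | hz
  · obtain ⟨t, rfl⟩ := Int.eq_ofNat_of_zero_le hz
    have := JM_bound_nat j k t (by exact_mod_cast h)
    rw [abs_of_nonneg hz]; omega
  · obtain ⟨t, ht⟩ := Int.eq_ofNat_of_zero_le (neg_nonneg.2 hz)
    have h2 := EigIn_JM_neg j k _ h
    have h3 : (-(z : ℝ)) = (t : ℝ) := by exact_mod_cast ht
    rw [h3] at h2
    have := JM_bound_nat j k t h2
    rw [abs_of_nonpos hz]; omega

theorem JM_norm (j : ℕ) (k : Fin n) (v : EE n) (hv : v ∈ VV n j) (hj : j + 1 ≤ n) :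
    ‖JM k v‖ ≤ ((n : ℝ) - j - 1) * ‖v‖ := by
  have hj' : (j : ℝ) + 1 ≤ n := by exact_mod_cast hj
  have := spectral_norm_le (VV n j) (JM k) (JM_symm k) (fun v hv => (VV_RInv j).JM k v hv) 1 0
    ((n : ℝ) - j - 1) (by linarith) ?_ v hv
  · simpa using this
  · intro a ha
    obtain ⟨z, rfl, hz⟩ := JM_bound j k a ha
    have : ((|z| : ℤ) : ℝ) + 1 + j ≤ n := by exact_mod_cast hz
    rw [Int.cast_abs] at this
    simp only [pow_one, sub_zero]; linarith

/-- eigenvalues of the sum of the two last JM operators -/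
theorem D_bound (j : ℕ) (k k' : Fin n) (h : (k' : ℕ) = k + 1) (a : ℝ)
    (ha : EigIn (VV n j) (JM k + JM k') a) : |a| ≤ 2 * ((n : ℝ) - j) - 3 := by
  have hkk : k < k' := by rw [Fin.lt_def]; omega
  obtain ⟨v, hv, hv0, hD, b, hb⟩ := joint_eig (VV n j) (JM k + JM k') (JM k) (JM_symm k)
    (fun v hv => (VV_RInv j).JM k v hv) (fun v => by simp [JM_comm_JM hkk]) a ha
  have hb' : JM k' v = (a - b) • v := by
    rw [sub_smul, ← hD, ← hb]; simp
  obtain ⟨z, hz, hzb⟩ := JM_bound j k b ⟨v, hv, hv0, hb⟩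
  obtain ⟨z', hz', hzb'⟩ := JM_bound j k' (a - b) ⟨v, hv, hv0, hb'⟩
  have hne := (swap_core (VV n j) (RR n (swap k k')) (JM k) (JM k') (RR_swap_swap _ _) (JM_swap h)
    (JM_symm _) (fun v hv => VV_RInv j _ v hv) v hv hv0 _ _ hb hb').1
  have hne' : z' ≠ z := by
    intro h; apply hne; rw [hz', h, ← hz]
  have hb1 := abs_le.1 (show |z| ≤ n - 1 - j by omega)
  have hb2 := abs_le.1 (show |z'| ≤ n - 1 - j by omega)
  have e : a = ((z + z' : ℤ) : ℝ) := by push_cast; linarith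
  have e2 : |z + z'| ≤ 2 * ((n : ℤ) - j) - 3 := by
    rw [abs_le]; omega
  have e3 : ((|z + z'| : ℤ) : ℝ) ≤ ((2 * ((n : ℤ) - j) - 3 : ℤ) : ℝ) := by exact_mod_cast e2
  rw [e, ← Int.cast_abs]
  push_cast at e3 ⊢
  exact e3

/-- `VV n j` vanishes for `j ≥ n - 1`. -/
theorem VV_nonzero (j : ℕ) (hn : 2 ≤ n) (v : EE n) (hv : v ∈ VV n j) (hv0 : v ≠ 0) : j + 2 ≤ n := by
  set k : Fin n := ⟨0, by omega⟩
  set k' : Fin n := ⟨1, by omega⟩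
  have hs : (JM k + JM k').IsSymmetric := (JM_symm k).add (JM_symm k')
  obtain ⟨a, ha⟩ := exists_eigIn (VV n j) (JM k + JM k') hs
    (fun v hv => (VV n j).add_mem ((VV_RInv j).JM k v hv) ((VV_RInv j).JM k' v hv)) v hv hv0
  have := D_bound j k k' rfl a ha
  have h0 := (abs_nonneg a).trans this
  have h1 : (2 * (j : ℝ) + 3) ≤ 2 * n := by linarith
  have h2 : 2 * j + 3 ≤ 2 * n := by exact_mod_cast h1
  omega

end Filt

section Ops
open Equiv
variable {n : ℕ}

noncomputable def CC (α : alternatingGroup (Fin n) → ℝ) : Module.End ℝ (EE n) :=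
  ∑ g, α g • RR n (g : Perm (Fin n))

theorem CC_convolve (α β : alternatingGroup (Fin n) → ℝ) : CC (convolve α β) = CC α * CC β := by
  unfold CC convolve
  rw [Finset.sum_mul_sum]
  simp only [Finset.sum_smul]
  rw [Finset.sum_comm]
  refine Finset.sum_congr rfl fun g _ => ?_
  refine Fintype.sum_equiv (Equiv.mulLeft g⁻¹) _ _ fun x => ?_
  simp only [Equiv.coe_mulLeft, smul_mul_smul_comm, ← map_mul]
  simp

theorem CC_pow (γ : alternatingGroup (Fin n) → ℝ) (k : ℕ) : CC (convPow γ k) = CC γ ^ k := by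
  induction k with
  | zero =>
    unfold CC convPow
    rw [Finset.sum_eq_single 1]
    · simp
    · intro b _ hb; simp [hb]
    · simp
  | succ k ih => rw [convPow, CC_convolve, ih, pow_succ]

theorem CC_sub (α β : alternatingGroup (Fin n) → ℝ) : CC (fun g => α g - β g) = CC α - CC β := by
  unfold CC
  rw [← Finset.sum_sub_distrib]
  exact Finset.sum_congr rfl fun g _ => sub_smul _ _ _

noncomputable def eb (n : ℕ) : OrthonormalBasis (Perm (Fin n)) ℝ (EE n) := EuclideanSpace.basisFun _ ℝ

theorem RR_eb (g τ : Perm (Fin n)) : RR n g (eb n τ) = eb n (τ * g⁻¹) := by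
  ext σ
  simp [eb, eq_mul_inv_iff_mul_eq]

theorem CC_hs (H : alternatingGroup (Fin n) → ℝ) :
    ∑ τ : Perm (Fin n), ‖CC H (eb n τ)‖ ^ 2 = (n.factorial : ℝ) * ∑ g, H g ^ 2 := by
  have h : ∀ τ : Perm (Fin n), ‖CC H (eb n τ)‖ ^ 2 = ∑ g, H g ^ 2 := by
    intro τ
    have e : CC H (eb n τ) = ∑ g : alternatingGroup (Fin n), H g • eb n (τ * (g : Perm (Fin n))⁻¹) := by
      simp [CC, RR_eb]
    have ho : Orthonormal ℝ (fun g : alternatingGroup (Fin n) => eb n (τ * (g : Perm (Fin n))⁻¹)) := by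
      refine (eb n).orthonormal.comp (fun g : alternatingGroup (Fin n) => τ * (g : Perm (Fin n))⁻¹) ?_
      intro g h hgh
      simpa using hgh
    rw [← real_inner_self_eq_norm_sq, e, ho.inner_sum]
    exact Finset.sum_congr rfl fun g _ => by simp [sq]
  simp only [h, Finset.sum_const, Finset.card_univ, Fintype.card_perm, Fintype.card_fin, nsmul_eq_mul]

theorem RInv.CC {U : Submodule ℝ (EE n)} (h : RInv U) (α : alternatingGroup (Fin n) → ℝ) (v : EE n)
    (hv : v ∈ U) : CC α v ∈ U := by
  simp only [_root_.CC, LinearMap.sum_apply, LinearMap.smul_apply]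
  exact U.sum_mem fun i _ => U.smul_mem _ (h _ v hv)

theorem sum_alt {M : Type*} [AddCommMonoid M] (f : Perm (Fin n) → M)
    (h : ∀ g, f g ≠ 0 → g ∈ alternatingGroup (Fin n)) :
    ∑ g : alternatingGroup (Fin n), f g = ∑ g : Perm (Fin n), f g := by
  rw [← Finset.sum_subtype (Finset.univ.filter (· ∈ alternatingGroup (Fin n))) (by simp) f]
  exact Finset.sum_filter_of_ne fun g _ hg => h g hg

noncomputable def S3 (n : ℕ) : Module.End ℝ (EE n) :=
  ∑ g ∈ Finset.univ.filter (fun g : Perm (Fin n) => g.IsThreeCycle), RR n g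

theorem CC_Q : CC (Qmeas n) = (3 / ((n : ℝ) * ((n : ℝ) - 1) * ((n : ℝ) - 2))) • S3 n := by
  unfold CC S3
  rw [Finset.smul_sum, Finset.sum_filter]
  rw [← sum_alt]
  · refine Finset.sum_congr rfl fun g _ => ?_
    unfold Qmeas
    split_ifs <;> simp
  · intro g hg
    have : g.IsThreeCycle := by by_contra hc; simp [hc] at hg
    exact this.mem_alternatingGroup

theorem S3_comm (g : Perm (Fin n)) (v : EE n) : RR n g (S3 n v) = S3 n (RR n g v) := by
  simp only [S3, LinearMap.sum_apply, map_sum, ← RR_mul_apply]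
  refine Finset.sum_equiv (MulAut.conj g).toEquiv ?_ ?_
  · intro h
    rw [Finset.mem_filter, Finset.mem_filter]
    show _ ↔ _ ∧ (g * h * g⁻¹).IsThreeCycle
    rw [Perm.IsThreeCycle, Perm.IsThreeCycle, Perm.cycleType_conj]
    simp
  · intro h _
    simp

theorem S3_symm : (S3 n).IsSymmetric := by
  intro x y
  simp only [S3, LinearMap.sum_apply, sum_inner, inner_sum]
  refine Finset.sum_equiv (Equiv.inv _) ?_ ?_
  · intro g; simp
  · intro g _
    rw [RR_inner]; simp

theorem S3_MM (v : EE n) : MM n (S3 n v) = S3 n (MM n v) := by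
  simp only [S3, LinearMap.sum_apply, map_sum]
  refine Finset.sum_congr rfl fun g hg => ?_
  rw [MM_RR, sg, if_pos rfl, (Finset.mem_filter.1 hg).2.sign]
  simp

theorem JM_sq_apply (k : Fin n) (v : EE n) : JM k (JM k v) =
    ((k : ℕ) : ℝ) • v + ∑ p ∈ (Finset.Iio k ×ˢ Finset.Iio k).filter (fun p => p.1 ≠ p.2),
      RR n (swap p.1 k * swap p.2 k) v := by
  have h1 : JM k (JM k v) = ∑ p ∈ Finset.Iio k ×ˢ Finset.Iio k, RR n (swap p.1 k * swap p.2 k) v := by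
    rw [Finset.sum_product, JM_apply]
    refine Finset.sum_congr rfl fun i _ => ?_
    rw [JM_apply, map_sum]
    exact Finset.sum_congr rfl fun j _ => (RR_mul_apply _ _ _).symm
  rw [h1, ← Finset.sum_filter_add_sum_filter_not _ (fun p => p.1 = p.2)]
  congr 1
  have h2 : ∀ p ∈ (Finset.Iio k ×ˢ Finset.Iio k).filter (fun p => p.1 = p.2),
      RR n (swap p.1 k * swap p.2 k) v = v := by
    rintro ⟨i, j⟩ hp
    obtain rfl : i = j := (Finset.mem_filter.1 hp).2
    simp
  rw [Finset.sum_congr rfl h2, Finset.sum_const]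
  have h3 : (Finset.Iio k ×ˢ Finset.Iio k).filter (fun p => p.1 = p.2) = (Finset.Iio k).image (fun i => (i, i)) := by
    ext ⟨i, j⟩
    simp only [Finset.mem_filter, Finset.mem_product, Finset.mem_image, Prod.mk.injEq]
    constructor
    · rintro ⟨⟨h1, h2⟩, rfl⟩; exact ⟨i, h1, rfl, rfl⟩
    · rintro ⟨a, ha, rfl, rfl⟩; exact ⟨⟨ha, ha⟩, rfl⟩
  rw [h3, Finset.card_image_of_injective _ (fun a b h => (Prod.mk.inj h).1), Fin.card_Iio]
  exact (Nat.cast_smul_eq_nsmul ℝ _ _).symm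

theorem sum_S3 (v : EE n) : S3 n v = ∑ k : Fin n,
    ∑ p ∈ (Finset.Iio k ×ˢ Finset.Iio k).filter (fun p => p.1 ≠ p.2), RR n (swap p.1 k * swap p.2 k) v := by
  rw [Finset.sum_sigma']
  simp only [S3, LinearMap.sum_apply]
  symm
  have key : ∀ k i j : Fin n, i < k → j < k → i ≠ j →
      (swap i k * swap j k) k = j ∧ (swap i k * swap j k) i = k ∧
      ∀ x, k < x → (swap i k * swap j k) x = x := by
    intro k i j hi hj hij
    refine ⟨?_, ?_, ?_⟩
    · rw [Perm.mul_apply, swap_apply_right, swap_apply_of_ne_of_ne hij.symm hj.ne]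
    · rw [Perm.mul_apply, swap_apply_of_ne_of_ne hij hi.ne, swap_apply_left]
    · intro x hx
      rw [Perm.mul_apply, swap_apply_of_ne_of_ne (hj.trans hx).ne' hx.ne',
        swap_apply_of_ne_of_ne (hi.trans hx).ne' hx.ne']
  refine Finset.sum_bij (fun q _ => swap q.2.1 q.1 * swap q.2.2 q.1) ?_ ?_ ?_ ?_
  · rintro ⟨k, i, j⟩ h
    simp only [Finset.mem_sigma, Finset.mem_univ, Finset.mem_filter, Finset.mem_product, Finset.mem_Iio, true_and] at h ⊢
    rw [swap_comm i k, swap_comm j k]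
    exact Perm.isThreeCycle_swap_mul_swap_same h.1.1.ne' h.1.2.ne' h.2
  · rintro ⟨k, i, j⟩ h ⟨k', i', j'⟩ h' e
    simp only [Finset.mem_sigma, Finset.mem_univ, Finset.mem_filter, Finset.mem_product, Finset.mem_Iio, true_and] at h h' e
    obtain ⟨a1, a2, a3⟩ := key k i j h.1.1 h.1.2 h.2
    obtain ⟨b1, b2, b3⟩ := key k' i' j' h'.1.1 h'.1.2 h'.2
    rw [e] at a1 a2 a3
    obtain rfl : k = k' := by
      rcases lt_trichotomy k k' with hl | hl | hl
      · have := a3 _ hl; rw [b1] at this; exact absurd this h'.1.2.ne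
      · exact hl
      · have := b3 _ hl; rw [a1] at this; exact absurd this h.1.2.ne
    obtain rfl : j = j' := a1.symm.trans b1
    obtain rfl : i = i' := Equiv.injective _ (a2.trans b2.symm)
    rfl
  · intro g hg
    have hg : g.IsThreeCycle := (Finset.mem_filter.1 hg).2
    have hne : g.support.Nonempty := by
      rw [← Finset.card_pos, hg.card_support]; norm_num
    set k := g.support.max' hne with hk
    have hks : k ∈ g.support := Finset.max'_mem _ _
    have hnd := hg.nodup_iff_mem_support.2 hks
    have heq := hg.eq_swap_mul_swap_iff_mem_support.2 hks
    have hle : ∀ x ∈ g.support, x ≤ k := fun x hx => Finset.le_max' _ x hx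
    have h1 : g k ∈ g.support := Perm.apply_mem_support.2 hks
    have h2 : g (g k) ∈ g.support := Perm.apply_mem_support.2 h1
    simp only [List.nodup_cons, List.mem_cons, List.not_mem_nil, or_false, not_or] at hnd
    refine ⟨⟨k, g (g k), g k⟩, ?_, ?_⟩
    · simp only [Finset.mem_sigma, Finset.mem_univ, Finset.mem_filter, Finset.mem_product, Finset.mem_Iio, true_and]
      exact ⟨⟨lt_of_le_of_ne (hle _ h2) (Ne.symm hnd.1.2), lt_of_le_of_ne (hle _ h1) (Ne.symm hnd.1.1)⟩, Ne.symm hnd.2.1⟩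
    · show swap (g (g k)) k * swap (g k) k = g
      conv_rhs => rw [heq]
      rw [Equiv.mul_swap_eq_swap_mul (swap k (g k)), swap_apply_right,
        swap_apply_of_ne_of_ne (Ne.symm hnd.1.2) (Ne.symm hnd.2.1), swap_comm k, swap_comm k]
  · rintro ⟨k, i, j⟩ h; rfl

/-- sum of squares of JM operators -/
theorem JM_sum_norm (v : EE n) (s : ℝ) (h : S3 n v = s • v) :
    ∑ k : Fin n, ‖JM k v‖ ^ 2 = ((n : ℝ) * (n - 1) / 2 + s) * ‖v‖ ^ 2 := by
  have h1 : ∀ k : Fin n, ‖JM k v‖ ^ 2 = inner ℝ v (JM k (JM k v)) := by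
    intro k
    rw [← real_inner_self_eq_norm_sq, JM_symm k]
  have h2 : ∑ k : Fin n, JM k (JM k v) = ((n : ℝ) * (n - 1) / 2 + s) • v := by
    simp only [JM_sq_apply]
    rw [Finset.sum_add_distrib, ← sum_S3, h, ← Finset.sum_smul, add_smul]
    congr 2
    rw [Fin.sum_univ_eq_sum_range (fun i => (i : ℝ)) n]
    clear h h1 v
    induction n with
    | zero => simp
    | succ n ih => rw [Finset.sum_range_succ, ih]; push_cast; ring
  simp only [h1]
  rw [← inner_sum, h2, inner_smul_right, real_inner_self_eq_norm_sq]

/-- the operator of `P` -/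
theorem CC_P (a b : Fin n) (ha : (a : ℕ) + 2 = n) (hb : (b : ℕ) + 1 = n) :
    CC (Pmeas n) = (1 / (2 * (n : ℝ) - 3)) • ((JM a + JM b) * RR n (swap a b)) := by
  have hab : a < b := by rw [Fin.lt_def]; omega
  have hI : Finset.Iio b = insert a (Finset.Iio a) := by
    ext x; simp only [Finset.mem_Iio, Finset.mem_insert, Fin.lt_def, Fin.ext_iff]; omega
  set Pp : Perm (Fin n) → Prop := fun g => g.IsThreeCycle ∧ a ∈ g.support ∧ b ∈ g.support with hPp
  have hcond : ∀ g : Perm (Fin n), (g.IsThreeCycle ∧ (∀ x : Fin n, n - 2 ≤ (x : ℕ) → x ∈ g.support)) ↔ Pp g := by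
    intro g
    refine and_congr_right fun _ => ⟨fun h => ⟨h a (by omega), h b (by omega)⟩, ?_⟩
    rintro ⟨h1, h2⟩ x hx
    have : x = a ∨ x = b := by
      rw [Fin.ext_iff, Fin.ext_iff]; omega
    rcases this with rfl | rfl <;> assumption
  have e1 : CC (Pmeas n) = (1 / (2 * (n : ℝ) - 3)) • (1 + ∑ g ∈ Finset.univ.filter Pp, RR n g) := by
    unfold CC
    have : ∀ g : Perm (Fin n), (if g = 1 then (1 : ℝ) else 0) • RR n g + (if Pp g then (1:ℝ) else 0) • RR n g ≠ 0 →
        g ∈ alternatingGroup (Fin n) := by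
      intro g hg
      by_cases h1 : g = 1
      · rw [h1]; exact one_mem _
      by_cases h2 : Pp g
      · exact h2.1.mem_alternatingGroup
      · simp [h1, h2] at hg
    have e2 : (1 + ∑ g ∈ Finset.univ.filter Pp, RR n g : Module.End ℝ (EE n)) = ∑ g : Perm (Fin n), ((if g = 1 then (1 : ℝ) else 0) • RR n g + (if Pp g then (1:ℝ) else 0) • RR n g) := by
      rw [Finset.sum_add_distrib, Finset.sum_filter]
      congr 1
      · simp
      · exact Finset.sum_congr rfl fun g _ => by split_ifs <;> simp
    rw [e2, ← sum_alt _ this, Finset.smul_sum]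
    refine Finset.sum_congr rfl fun g _ => ?_
    unfold Pmeas
    by_cases h1 : (g : Perm (Fin n)) = 1
    · have h2 : ¬ Pp g := fun h => h.1.ne_one h1
      rw [if_pos h1, if_pos h1, if_neg h2]; simp
    · rw [if_neg h1, if_neg h1]
      by_cases h2 : Pp g
      · rw [if_pos h2, if_pos ((hcond _).2 h2)]; simp
      · rw [if_neg h2, if_neg (fun h => h2 ((hcond _).1 h))]; simp
  rw [e1]
  congr 1
  have hfix : ∀ g : Perm (Fin n), Pp g → g = swap a (g a) * swap (g a) (g (g a)) ∧ a ≠ g a ∧ a ≠ g (g a) ∧ g a ≠ g (g a)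
      ∧ g (g (g a)) = a ∧ (b = g a ∨ b = g (g a)) := by
    intro g hg
    have hnd := hg.1.nodup_iff_mem_support.2 hg.2.1
    have heq := hg.1.eq_swap_mul_swap_iff_mem_support.2 hg.2.1
    have hs := hg.1.support_eq_iff_mem_support.2 hg.2.1
    simp only [List.nodup_cons, List.mem_cons, List.not_mem_nil, or_false, not_or] at hnd
    refine ⟨heq, hnd.1.1, hnd.1.2, hnd.2.1, ?_, ?_⟩
    · conv_lhs => rw [heq]
      rw [Perm.mul_apply]
      rw [← heq, swap_apply_right, swap_apply_right]
    · have := hg.2.2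
      rw [hs] at this
      simpa [hab.ne'] using this
  have s1 : ∑ g ∈ (Finset.univ.filter Pp).filter (fun g => g a = b), RR n g = ∑ i ∈ Finset.Iio a, RR n (swap i a * swap a b) := by
    symm
    refine Finset.sum_bij (fun i _ => swap i a * swap a b) ?_ ?_ ?_ (fun _ _ => rfl)
    · intro i hi
      have hi : i < a := by simpa using hi
      have h0 : (swap i a * swap a b).IsThreeCycle := by
        rw [swap_comm i a]; exact Perm.isThreeCycle_swap_mul_swap_same hi.ne' hab.ne (hi.trans hab).ne
      have h1 : (swap i a * swap a b) a = b := by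
        rw [Perm.mul_apply, swap_apply_left, swap_apply_of_ne_of_ne (hi.trans hab).ne' hab.ne']
      have h2 : (swap i a * swap a b) b = i := by
        rw [Perm.mul_apply, swap_apply_right, swap_apply_right]
      simp only [Finset.mem_filter, Finset.mem_univ, true_and]
      refine ⟨⟨h0, ?_, ?_⟩, h1⟩
      · rw [Perm.mem_support, h1]; exact hab.ne'
      · rw [Perm.mem_support, h2]; exact (hi.trans hab).ne
    · intro i _ j _ h
      have := congrArg (fun g : Perm (Fin n) => g b) h
      simpa using this
    · intro g hg
      simp only [Finset.mem_filter, Finset.mem_univ, true_and] at hg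
      obtain ⟨hP, h2⟩ := hg
      obtain ⟨f1, f2, f3, f4, f5, f6⟩ := hfix g hP
      rw [h2] at f1 f3 f4 f5
      refine ⟨g b, ?_, ?_⟩
      · have : g b ∈ Finset.Iio b := by
          rw [Finset.mem_Iio, Fin.lt_def]
          have : (g b : ℕ) ≠ b := fun h => f4 (Fin.ext h.symm)
          omega
        rw [hI, Finset.mem_insert] at this
        exact this.resolve_left (Ne.symm f3)
      · conv_rhs => rw [f1]
        rw [Equiv.mul_swap_eq_swap_mul (swap a b), swap_apply_right,
          swap_apply_of_ne_of_ne (Ne.symm f3) (Ne.symm f4), swap_comm a (g b)]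
  have s2 : ∑ g ∈ (Finset.univ.filter Pp).filter (fun g => ¬ g a = b), RR n g = ∑ i ∈ Finset.Iio a, RR n (swap i b * swap a b) := by
    symm
    refine Finset.sum_bij (fun i _ => swap i b * swap a b) ?_ ?_ ?_ (fun _ _ => rfl)
    · intro i hi
      have hi : i < a := by simpa using hi
      have h0 : (swap i b * swap a b).IsThreeCycle := by
        rw [swap_comm i b, swap_comm a b]; exact Perm.isThreeCycle_swap_mul_swap_same (hi.trans hab).ne' hab.ne' hi.ne
      have h1 : (swap i b * swap a b) a = i := by
        rw [Perm.mul_apply, swap_apply_left, swap_apply_right]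
      have h2 : (swap i b * swap a b) b = a := by
        rw [Perm.mul_apply, swap_apply_right, swap_apply_of_ne_of_ne hi.ne' hab.ne]
      simp only [Finset.mem_filter, Finset.mem_univ, true_and]
      refine ⟨⟨h0, ?_, ?_⟩, ?_⟩
      · rw [Perm.mem_support, h1]; exact hi.ne
      · rw [Perm.mem_support, h2]; exact hab.ne
      · rw [h1]; exact (hi.trans hab).ne
    · intro i _ j _ h
      have := congrArg (fun g : Perm (Fin n) => g a) h
      simpa using this
    · intro g hg
      simp only [Finset.mem_filter, Finset.mem_univ, true_and] at hg
      obtain ⟨hP, h2⟩ := hg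
      obtain ⟨f1, f2, f3, f4, f5, f6⟩ := hfix g hP
      have f7 : g (g a) = b := (f6.resolve_left (Ne.symm h2)).symm
      rw [f7] at f1 
      refine ⟨g a, ?_, ?_⟩
      · have : g a ∈ Finset.Iio b := by
          rw [Finset.mem_Iio, Fin.lt_def]
          have : (g a : ℕ) ≠ b := fun h => h2 (Fin.ext h)
          omega
        rw [hI, Finset.mem_insert] at this
        exact this.resolve_left (Ne.symm f2)
      · conv_rhs => rw [f1]
        rw [Equiv.mul_swap_eq_swap_mul (swap (g a) b), swap_apply_right,
          swap_apply_of_ne_of_ne f2 hab.ne]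
  rw [← Finset.sum_filter_add_sum_filter_not _ (fun g : Perm (Fin n) => g a = b), s1, s2, add_mul, JM, JM, hI,
    Finset.sum_insert (by simp), add_mul, Finset.sum_mul, Finset.sum_mul]
  simp only [← map_mul, swap_mul_self, map_one]
  abel
end Ops

section Bounds
open Equiv
variable {n : ℕ}

theorem RR_norm (g : Perm (Fin n)) (v : EE n) : ‖RR n g v‖ = ‖v‖ := by
  have : ‖RR n g v‖ ^ 2 = ‖v‖ ^ 2 := by
    rw [← real_inner_self_eq_norm_sq, ← real_inner_self_eq_norm_sq, RR_inner, ← RR_mul_apply]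
    simp
  exact (sq_eq_sq₀ (norm_nonneg _) (norm_nonneg _)).1 this

theorem P_bound (j : ℕ) (hj : j + 2 ≤ n) (v : EE n) (hv : v ∈ VV n j) :
    ‖CC (Pmeas n) v‖ ≤ ((2 * ((n : ℝ) - j) - 3) / (2 * n - 3)) * ‖v‖ := by
  set a : Fin n := ⟨n - 2, by omega⟩ with ha
  set b : Fin n := ⟨n - 1, by omega⟩ with hb
  have hj' : (j : ℝ) + 2 ≤ n := by exact_mod_cast hj
  have hj0 : (0 : ℝ) ≤ j := Nat.cast_nonneg _
  rw [CC_P a b (by simp [ha]; omega) (by simp [hb]; omega)]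
  have h1 := spectral_norm_le (VV n j) (JM a + JM b) ((JM_symm a).add (JM_symm b))
    (fun v hv => (VV n j).add_mem ((VV_RInv j).JM a v hv) ((VV_RInv j).JM b v hv)) 1 0
    (2 * ((n : ℝ) - j) - 3) (by linarith) (fun x hx => by
      simpa using D_bound j a b (by simp [ha, hb]; omega) x hx) (RR n (swap a b) v) (VV_RInv j _ v hv)
  rw [RR_norm] at h1
  simp only [pow_one, zero_smul, sub_zero] at h1
  rw [LinearMap.smul_apply, Module.End.mul_apply, norm_smul, Real.norm_of_nonneg (by apply div_nonneg <;> linarith)]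
  calc _ ≤ 1 / (2 * (n : ℝ) - 3) * ((2 * ((n : ℝ) - j) - 3) * ‖v‖) := by
        apply mul_le_mul_of_nonneg_left h1; apply div_nonneg <;> linarith
    _ = _ := by ring

theorem P_pow_bound (j : ℕ) (hj : j + 2 ≤ n) (l : ℕ) (v : EE n) (hv : v ∈ VV n j) :
    ‖(CC (Pmeas n) ^ l) v‖ ≤ ((2 * ((n : ℝ) - j) - 3) / (2 * n - 3)) ^ l * ‖v‖ := by
  have hj' : (j : ℝ) + 2 ≤ n := by exact_mod_cast hj
  have hj0 : (0 : ℝ) ≤ j := Nat.cast_nonneg _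
  induction l generalizing v with
  | zero => simp
  | succ l ih =>
    rw [pow_succ, Module.End.mul_apply]
    refine (ih _ ((VV_RInv j).CC _ v hv)).trans ?_
    rw [pow_succ, mul_assoc]
    apply mul_le_mul_of_nonneg_left (P_bound j hj v hv)
    apply pow_nonneg; apply div_nonneg <;> linarith

theorem S3_bound_all (j : ℕ) (hj : j + 2 ≤ n) (s : ℝ) (h : EigIn (VV n j) (S3 n) s) :
    0 ≤ (n : ℝ) * (n - 1) / 2 + s ∧ (n : ℝ) * (n - 1) / 2 + s ≤ n * ((n : ℝ) - j - 1) ^ 2 := by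
  obtain ⟨v, hv, hv0, h⟩ := h
  have h1 := JM_sum_norm v s h
  have h2 : 0 < ‖v‖ ^ 2 := by positivity
  constructor
  · have : 0 ≤ ∑ k : Fin n, ‖JM k v‖ ^ 2 := Finset.sum_nonneg fun k _ => sq_nonneg _
    rw [h1] at this
    exact nonneg_of_mul_nonneg_left this h2
  · have : ∑ k : Fin n, ‖JM k v‖ ^ 2 ≤ ∑ k : Fin n, (((n : ℝ) - j - 1) * ‖v‖) ^ 2 := by
      refine Finset.sum_le_sum fun k _ => ?_
      exact pow_le_pow_left₀ (norm_nonneg _) (JM_norm j k v hv (by omega)) 2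
    rw [h1, Finset.sum_const, Finset.card_univ, Fintype.card_fin, nsmul_eq_mul, mul_pow, ← mul_assoc] at this
    exact le_of_mul_le_mul_right this h2

/-- vectors fixed by the pointwise stabilizer of the last points -/
noncomputable def WW (n j : ℕ) : Submodule ℝ (EE n) where
  carrier := {v | v ∈ VV n j ∧ ∀ g : Perm (Fin n), (∀ x : Fin n, n - j ≤ (x : ℕ) → g x = x) → RR n g v = v}
  add_mem' := by
    rintro a b ⟨h1, h2⟩ ⟨h3, h4⟩
    exact ⟨Submodule.add_mem _ h1 h3, fun g hg => by rw [map_add, h2 g hg, h4 g hg]⟩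
  zero_mem' := ⟨Submodule.zero_mem _, fun g _ => map_zero _⟩
  smul_mem' := by
    rintro c a ⟨h1, h2⟩
    exact ⟨Submodule.smul_mem _ _ h1, fun g hg => by rw [map_smul, h2 g hg]⟩

theorem exists_W (j : ℕ) (hj : j ≤ n) (s : ℝ) (h : EigIn (VV n j) (S3 n) s) :
    EigIn (WW n j) (S3 n) s := by
  obtain ⟨v, hv, hv0, h⟩ := h
  obtain ⟨A, b, ε, hA, hne⟩ : ∃ A b ε, A.card = j ∧ inner ℝ (fA A b ε) v ≠ 0 := by
    by_contra hc
    push Not at hc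
    have : v ∈ (II n (j + 1))ᗮ := by
      rw [mem_II_orth]
      intro A b ε hA
      rcases Nat.lt_succ_iff_lt_or_eq.1 hA with h1 | h1
      · exact mem_II_orth.1 hv.2 A b ε h1
      · exact hc A b ε h1
    have := this v hv.1
    exact hv0 (by simpa using this)
  obtain ⟨v1, hv1, h1, hne1⟩ : ∃ v1 ∈ VV n j, S3 n v1 = s • v1 ∧ inner ℝ (fA A b false) v1 ≠ 0 := by
    cases ε
    · exact ⟨v, hv, h, hne⟩
    · refine ⟨MM n v, VV_MM j v hv, ?_, ?_⟩
      · rw [← S3_MM, h, map_smul]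
      · rw [← MM_inner, MM_fA]; exact hne
  set B : Finset (Fin n) := Finset.univ.filter (fun x => n - j ≤ (x : ℕ)) with hB
  have hBc : B.card = j := by
    have h1 : B.card = (Finset.univ.filter (fun x : Fin n => ¬ ((x : ℕ) < n - j))).card := by
      congr 1; ext x; simp [hB]
    rw [h1]
    have h2 := Finset.card_filter_add_card_filter_not (s := (Finset.univ : Finset (Fin n))) (fun x : Fin n => (x : ℕ) < n - j)
    rw [Fin.card_filter_val_lt, Finset.card_univ, Fintype.card_fin] at h2
    omega
  obtain ⟨g, hg⟩ : ∃ g : Perm (Fin n), A.image g = B := by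
    have e : {x // x ∈ A} ≃ {x // x ∈ B} := Finset.equivOfCardEq (by rw [hA, hBc])
    refine ⟨e.extendSubtype, ?_⟩
    apply Finset.eq_of_subset_of_card_le
    · intro x hx
      obtain ⟨y, hy, rfl⟩ := Finset.mem_image.1 hx
      exact e.extendSubtype_mem y hy
    · rw [Finset.card_image_of_injective _ (Equiv.injective _), hA, hBc]
  set f := fA B (b ∘ ⇑g⁻¹) false with hf
  have hRf : RR n g (fA A b false) = f := by
    rw [RR_fA, hg]; simp [sg, hf]
  set w := RR n g v1 with hw
  have hwV : w ∈ VV n j := VV_RInv j g _ hv1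
  have hSw : S3 n w = s • w := by rw [hw, ← S3_comm, h1, map_smul]
  have hfw : inner ℝ f w ≠ 0 := by
    rw [← hRf, hw, RR_inner, ← RR_mul_apply]; simpa using hne1
  set K : Finset (Perm (Fin n)) := Finset.univ.filter (fun g => ∀ x : Fin n, n - j ≤ (x : ℕ) → g x = x) with hK
  have hmK : ∀ h : Perm (Fin n), h ∈ K ↔ ∀ x : Fin n, n - j ≤ (x : ℕ) → h x = x := by
    intro h; simp [hK]
  have hfix : ∀ h ∈ K, RR n h f = f := by
    intro h hh
    rw [hmK] at hh
    ext σ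
    rw [RR_apply, hf, fA_apply, fA_apply]
    have : (∀ x ∈ B, (σ * h) x = (b ∘ ⇑g⁻¹) x) ↔ (∀ x ∈ B, σ x = (b ∘ ⇑g⁻¹) x) := by
      refine forall₂_congr fun x hx => ?_
      rw [Perm.mul_apply, hh x (by simpa [hB] using hx)]
    simp only [this, sg]
    rfl
  have hinv : ∀ h ∈ K, h⁻¹ ∈ K := by
    intro h hh
    rw [hmK] at hh ⊢
    intro x hx
    rw [Perm.inv_eq_iff_eq, hh x hx]
  refine ⟨∑ h ∈ K, RR n h w, ⟨Submodule.sum_mem _ fun h _ => VV_RInv j h w hwV, ?_⟩, ?_, ?_⟩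
  · intro h hh
    rw [map_sum]
    refine Finset.sum_equiv (Equiv.mulLeft h) ?_ ?_
    · intro k
      rw [hmK, hmK]
      refine forall₂_congr fun x hx => ?_
      simp only [coe_mulLeft, Perm.mul_apply]
      constructor
      · intro hk; rw [hk, hh x hx]
      · intro hk
        have := hh x hx
        exact h.injective (hk.trans this.symm)
    · intro k _
      rw [← RR_mul_apply]; rfl
  · intro h0
    have : inner ℝ f (∑ h ∈ K, RR n h w) = (K.card : ℝ) * inner ℝ f w := by
      rw [inner_sum, Finset.sum_congr rfl (g := fun _ => inner ℝ f w), Finset.sum_const, nsmul_eq_mul]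
      intro h hh
      rw [real_inner_comm, RR_inner, hfix _ (hinv h hh), real_inner_comm]
    rw [h0, inner_zero_right] at this
    rcases mul_eq_zero.1 this.symm with h2 | h2
    · have h3 : K.card = 0 := by exact_mod_cast h2
      rw [Finset.card_eq_zero] at h3
      have : (1 : Perm (Fin n)) ∈ K := by rw [hmK]; simp
      rw [h3] at this
      simp at this
    · exact hfw h2
  · rw [map_sum, Finset.smul_sum]
    refine Finset.sum_congr rfl fun h _ => ?_
    rw [← S3_comm, hSw, map_smul]

theorem W_JM_lt (j : ℕ) (k : Fin n) (hk : (k : ℕ) < n - j) (v : EE n) (hv : v ∈ WW n j) :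
    JM k v = ((k : ℕ) : ℝ) • v := by
  rw [JM_apply, Finset.sum_congr rfl (g := fun _ => v)]
  · rw [Finset.sum_const, Fin.card_Iio]; exact (Nat.cast_smul_eq_nsmul ℝ _ _).symm
  · intro i hi
    have hi : i < k := by simpa using hi
    have hi' : (i : ℕ) < k := hi
    apply hv.2
    intro x hx
    apply swap_apply_of_ne_of_ne
    · intro h; rw [h] at hx; omega
    · intro h; rw [h] at hx; omega

theorem W_JM_eq (j : ℕ) (hj : 1 ≤ j) (k : Fin n) (hk : (k : ℕ) = n - j) (v : EE n) (hv : v ∈ WW n j) :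
    JM k v = - v := by
  have hu : JM k v + v = ∑ l ∈ Finset.Iic k, RR n (swap l k) v := by
    have : Finset.Iic k = insert k (Finset.Iio k) := by
      ext x; simp [le_iff_lt_or_eq, or_comm]
    rw [this, Finset.sum_insert (by simp), JM_apply, swap_self, ← Perm.one_def, map_one, add_comm]; rfl
  have hV : JM k v + v ∈ VV n j := Submodule.add_mem _ ((VV_RInv j).JM k v hv.1) hv.1
  have h0 : JM k v + v = 0 := by
    refine fixed_eq_zero (Finset.Ioi k) (j := j) ?_ _ hV.2 ?_
    · rw [Fin.card_Ioi]; omega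
    · intro g hg
      refine fixed_of_swaps k _ ?_ _ g le_rfl (fun x hx => hg x (by simpa using hx))
      intro i hi
      rw [hu, map_sum]
      refine Finset.sum_equiv (swap i k) ?_ ?_
      · intro l
        rw [Finset.mem_Iic, Finset.mem_Iic]
        rcases eq_or_ne l i with rfl | h1
        · simp [hi.le]
        rcases eq_or_ne l k with rfl | h2
        · simp [hi.le]
        rw [swap_apply_of_ne_of_ne h1 h2]
      · intro l hl
        rw [← RR_mul_apply]
        rcases eq_or_ne l i with rfl | h1
        · rw [swap_mul_self, swap_apply_left, swap_self, ← Perm.one_def]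
        rcases eq_or_ne l k with rfl | h2
        · rw [swap_apply_right, swap_self, ← Perm.one_def, mul_one]
        rw [swap_apply_of_ne_of_ne h1 h2]
        have e : swap i k * swap l k = swap l k * swap i l := by
          rw [Equiv.mul_swap_eq_swap_mul (swap l k), swap_apply_left, swap_apply_of_ne_of_ne h1.symm hi.ne]
        rw [e, RR_mul_apply]
        congr 1
        apply hv.2
        intro x hx
        have hl' : l < k := lt_of_le_of_ne (show l ≤ k by simpa using hl) h2
        have hi' : (i : ℕ) < k := hi
        rw [Fin.lt_def] at hl'
        apply swap_apply_of_ne_of_ne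
        · intro h; rw [h] at hx; omega
        · intro h; rw [h] at hx; omega
  exact eq_neg_of_add_eq_zero_left h0

theorem W_JM_mem (j : ℕ) (k : Fin n) (hk : n - j ≤ (k : ℕ)) (v : EE n) (hv : v ∈ WW n j) :
    JM k v ∈ WW n j := by
  refine ⟨(VV_RInv j).JM k v hv.1, fun g hg => ?_⟩
  rw [JM_comm_RR k g (hg k hk), hv.2 g hg]
  intro i
  by_cases hi : n - j ≤ (i : ℕ)
  · rw [hg i hi]
  · have h1 : (g i : ℕ) < n - j := by
      by_contra hc
      have := hg (g i) (by omega)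
      have := g.injective this
      rw [this] at hc; omega
    rw [Fin.lt_def, Fin.lt_def]; omega

theorem W_swap_mem (j : ℕ) (k k' : Fin n) (hk : n - j ≤ (k : ℕ)) (hk' : n - j ≤ (k' : ℕ)) (v : EE n) (hv : v ∈ WW n j) :
    RR n (swap k k') v ∈ WW n j := by
  refine ⟨VV_RInv j _ v hv.1, fun g hg => ?_⟩
  rw [← RR_mul_apply, Equiv.mul_swap_eq_swap_mul, hg k hk, hg k' hk', RR_mul_apply, hv.2 g hg]

theorem W_eig (j : ℕ) (hj : j ≤ n) (t : ℕ) : ∀ k : Fin n, (k : ℕ) = n - j + t → ∀ a, EigIn (WW n j) (JM k) a →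
    |a| ≤ t + 1 := by
  induction t with
  | zero =>
    rintro k hk a ⟨v, hv, hv0, h⟩
    rw [W_JM_eq j (by have := k.2; omega) k (by omega) v hv] at h
    have : (a + 1) • v = 0 := by rw [add_smul, ← h]; simp
    have ha : a = -1 := by
      have := (smul_eq_zero.1 this).resolve_right hv0; linarith
    rw [ha]; simp
  | succ t ih =>
    intro k' hk' a ha
    set k : Fin n := ⟨n - j + t, by have := k'.2; omega⟩ with hk
    obtain ⟨b, hb, hab⟩ := JM_spec_incl (U := WW n j) (k := k) (k' := k') (by simp [hk]; omega)
      (fun v hv => W_swap_mem j k k' (by simp [hk]) (by omega) v hv)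
      (fun v hv => W_JM_mem j k (by simp [hk]) v hv) a ha
    have := abs_le.1 (ih k rfl b hb)
    push_cast
    rw [abs_le]
    rcases hab with rfl | rfl | rfl <;> constructor <;> linarith [this.1, this.2]

theorem W_JM_ge (j : ℕ) (hj : j ≤ n) (t : ℕ) (k : Fin n) (hk : (k : ℕ) = n - j + t) (v : EE n) (hv : v ∈ WW n j) :
    ‖JM k v‖ ≤ ((t : ℝ) + 1) * ‖v‖ := by
  have := spectral_norm_le (WW n j) (JM k) (JM_symm k) (fun v hv => W_JM_mem j k (by omega) v hv) 1 0
    ((t : ℝ) + 1) (by positivity) (fun a ha => by simpa using W_eig j hj t k hk a ha) v hv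
  simpa using this

theorem sum_sq_range (m : ℕ) : ∑ k ∈ Finset.range m, (k : ℝ) ^ 2 = (m - 1) * m * (2 * m - 1) / 6 := by
  induction m with
  | zero => simp
  | succ m ih => rw [Finset.sum_range_succ, ih]; push_cast; ring

theorem sum_sq_range' (m : ℕ) : ∑ k ∈ Finset.range m, ((k : ℝ) + 1) ^ 2 = (m : ℝ) * (m + 1) * (2 * m + 1) / 6 := by
  induction m with
  | zero => simp
  | succ m ih => rw [Finset.sum_range_succ, ih]; push_cast; ring

theorem S3_bound_W (j : ℕ) (hj : j ≤ n) (s : ℝ) (h : EigIn (VV n j) (S3 n) s) :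
    ((n : ℝ) - j - 1) * (n - j) * (2 * (n - j) - 1) / 6 ≤ (n : ℝ) * (n - 1) / 2 + s ∧
    (n : ℝ) * (n - 1) / 2 + s ≤ ((n : ℝ) - j - 1) * (n - j) * (2 * (n - j) - 1) / 6
      + (j : ℝ) * (j + 1) * (2 * j + 1) / 6 := by
  obtain ⟨v, hv, hv0, h⟩ := exists_W j hj s h
  have h1 := JM_sum_norm v s h
  have h2 : 0 < ‖v‖ ^ 2 := by positivity
  set F : ℕ → ℝ := fun k => if hk : k < n then ‖JM (⟨k, hk⟩ : Fin n) v‖ ^ 2 else 0 with hF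
  have h3 : ∑ k : Fin n, ‖JM k v‖ ^ 2 = ∑ k ∈ Finset.range n, F k := by
    rw [← Fin.sum_univ_eq_sum_range F n]
    refine Finset.sum_congr rfl fun k _ => ?_
    simp [hF]
  have h4 : ∑ k ∈ Finset.range n, F k = ∑ k ∈ Finset.range (n - j), F k + ∑ t ∈ Finset.range j, F (n - j + t) := by
    have : n = (n - j) + j := by omega
    conv_lhs => rw [this]
    rw [Finset.sum_range_add]
  have hcast : ((n - j : ℕ) : ℝ) = (n : ℝ) - j := by push_cast [hj]; ring
  have h5 : ∑ k ∈ Finset.range (n - j), F k = ((n : ℝ) - j - 1) * (n - j) * (2 * (n - j) - 1) / 6 * ‖v‖ ^ 2 := by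
    rw [← hcast, ← sum_sq_range, Finset.sum_mul]
    refine Finset.sum_congr rfl fun k hk => ?_
    have hk := Finset.mem_range.1 hk
    have hkn : k < n := by omega
    simp only [hF, dif_pos hkn]
    rw [W_JM_lt j ⟨k, hkn⟩ hk v hv, norm_smul, mul_pow]
    simp
  have h6 : ∑ t ∈ Finset.range j, F (n - j + t) ≤ (j : ℝ) * (j + 1) * (2 * j + 1) / 6 * ‖v‖ ^ 2 := by
    rw [← sum_sq_range', Finset.sum_mul]
    refine Finset.sum_le_sum fun t ht => ?_
    have ht := Finset.mem_range.1 ht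
    have hkn : n - j + t < n := by omega
    simp only [hF, dif_pos hkn]
    rw [← mul_pow]
    exact pow_le_pow_left₀ (norm_nonneg _) (W_JM_ge j hj t ⟨n - j + t, hkn⟩ rfl v hv) 2
  have h7 : 0 ≤ ∑ t ∈ Finset.range j, F (n - j + t) := by
    refine Finset.sum_nonneg fun t _ => ?_
    simp only [hF]; split_ifs <;> positivity
  rw [h3, h4, h5] at h1
  constructor
  · refine le_of_mul_le_mul_right ?_ h2
    linarith
  · refine le_of_mul_le_mul_right ?_ h2
    rw [← h1, add_mul]; linarith
end Bounds

section Dim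
open Equiv
variable {n : ℕ}

noncomputable def GS (𝒜 : Finset (Finset (Fin n))) : Finset (EE n) :=
  𝒜.biUnion fun A => ((Fintype.piFinset fun x => if x ∈ A then Finset.univ else {x}) ×ˢ
    (Finset.univ : Finset Bool)).image fun p => fA A p.1 p.2

theorem GS_card (𝒜 : Finset (Finset (Fin n))) (j : ℕ) (h : ∀ A ∈ 𝒜, A.card = j) :
    (GS 𝒜).card ≤ 𝒜.card * (n ^ j * 2) := by
  refine Finset.card_biUnion_le_card_mul _ _ _ fun A hA => ?_
  refine Finset.card_image_le.trans ?_
  rw [Finset.card_product, Fintype.card_piFinset]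
  apply le_of_eq
  congr 1
  have : ∀ x : Fin n, (if x ∈ A then (Finset.univ : Finset (Fin n)) else {x}).card = if x ∈ A then n else 1 := by
    intro x; split_ifs <;> simp
  simp only [this]
  rw [Finset.prod_ite]
  simp [h A hA]

theorem GS_mem (𝒜 : Finset (Finset (Fin n))) (A : Finset (Fin n)) (hA : A ∈ 𝒜) (b : Fin n → Fin n) (ε : Bool) :
    fA A b ε ∈ Submodule.span ℝ (GS 𝒜 : Set (EE n)) := by
  apply Submodule.subset_span
  rw [Finset.mem_coe, GS, Finset.mem_biUnion]
  refine ⟨A, hA, Finset.mem_image.2 ⟨(fun x => if x ∈ A then b x else x, ε), ?_, ?_⟩⟩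
  · rw [Finset.mem_product, Fintype.mem_piFinset]
    refine ⟨fun x => ?_, Finset.mem_univ _⟩
    dsimp only
    split_ifs <;> simp
  · ext σ
    rw [fA_apply, fA_apply]
    have : (∀ x ∈ A, σ x = if x ∈ A then b x else x) ↔ (∀ x ∈ A, σ x = b x) :=
      forall₂_congr fun x hx => by rw [if_pos hx]
    simp only [this]

theorem finrank_VV (j : ℕ) : Module.finrank ℝ (VV n j) ≤ n.choose j * (n ^ j * 2) := by
  set 𝒜 := Finset.powersetCard j (Finset.univ : Finset (Fin n)) with h𝒜
  have h1 : VV n j ≤ II n j ⊔ Submodule.span ℝ (GS 𝒜 : Set (EE n)) := by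
    refine inf_le_left.trans ?_
    rw [II, Submodule.span_le]
    rintro f ⟨A, b, ε, hA, rfl⟩
    rcases Nat.lt_succ_iff_lt_or_eq.1 hA with h | h
    · exact Submodule.mem_sup_left (fA_mem h b ε)
    · exact Submodule.mem_sup_right (GS_mem 𝒜 A (by simp [h𝒜, Finset.mem_powersetCard, h]) b ε)
  have h2 := finrank_le_of_orth _ _ _ h1 inf_le_right
  refine h2.trans ((finrank_span_finset_le_card _).trans ((GS_card 𝒜 j ?_).trans ?_))
  · intro A hA; exact (Finset.mem_powersetCard.1 hA).2
  · rw [h𝒜, Finset.card_powersetCard]; simp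

/-- the bad sets -/
noncomputable def BS (a b : Fin n) (j : ℕ) : Finset (Finset (Fin n)) :=
  (Finset.powersetCard j Finset.univ).filter (fun A => a ∈ A ∨ b ∈ A)

theorem BS_card (a b : Fin n) (j : ℕ) : n * (BS a b j).card ≤ 2 * n ^ j := by
  have key : ∀ c : Fin n, n * ((Finset.powersetCard j (Finset.univ : Finset (Fin n))).filter (fun A => c ∈ A)).card ≤ n ^ j := by
    intro c
    rcases j with _ | j
    · have : (Finset.powersetCard 0 (Finset.univ : Finset (Fin n))).filter (fun A => c ∈ A) = ∅ := by
        ext A; simp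
        rintro rfl; simp
      rw [this]; simp
    · rw [pow_succ, mul_comm]
      apply Nat.mul_le_mul_right
      have : ((Finset.powersetCard (j + 1) (Finset.univ : Finset (Fin n))).filter (fun A => c ∈ A)).card
          ≤ (Finset.powersetCard j (Finset.univ : Finset (Fin n))).card := by
        refine Finset.card_le_card_of_injOn (fun A => A.erase c) ?_ ?_
        · intro A hA
          simp only [Finset.coe_filter, Finset.mem_powersetCard, Set.mem_ofPred_eq] at hA
          simp only [Finset.mem_coe, Finset.mem_powersetCard]
          refine ⟨Finset.subset_univ _, ?_⟩
          rw [Finset.card_erase_of_mem hA.2, hA.1.2]; rfl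
        · intro A hA B hB h
          simp only [Finset.coe_filter, Set.mem_ofPred_eq] at hA hB
          rw [← Finset.insert_erase hA.2, ← Finset.insert_erase hB.2]
          simp only at h
          rw [h]
      refine this.trans ?_
      rw [Finset.card_powersetCard, Finset.card_univ, Fintype.card_fin]
      exact Nat.choose_le_pow n j
  have : (BS a b j).card ≤ ((Finset.powersetCard j (Finset.univ : Finset (Fin n))).filter (fun A => a ∈ A)).card
      + ((Finset.powersetCard j (Finset.univ : Finset (Fin n))).filter (fun A => b ∈ A)).card := by
    rw [BS, Finset.filter_or]; exact Finset.card_union_le _ _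
  calc _ ≤ n * _ := Nat.mul_le_mul_left _ this
    _ ≤ _ := by rw [mul_add, two_mul]; exact add_le_add (key a) (key b)

theorem P_fA (a b : Fin n) (ha : (a : ℕ) + 2 = n) (hb : (b : ℕ) + 1 = n) (f : EE n) :
    CC (Pmeas n) f = (1 / (2 * (n : ℝ) - 3)) • (f + ∑ i ∈ Finset.Iio a, RR n (swap i a * swap a b) f
      + ∑ i ∈ Finset.Iio a, RR n (swap i b * swap a b) f) := by
  have hI : Finset.Iio b = insert a (Finset.Iio a) := by
    ext x; simp only [Finset.mem_Iio, Finset.mem_insert, Fin.lt_def, Fin.ext_iff]; omega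
  rw [CC_P a b ha hb, LinearMap.smul_apply, Module.End.mul_apply, LinearMap.add_apply, JM_apply, JM_apply, hI,
    Finset.sum_insert (by simp), RR_swap_swap]
  simp only [← RR_mul_apply]
  congr 1
  abel

theorem three_sum (a b : Fin n) (ha : (a : ℕ) + 2 = n) (hb : (b : ℕ) + 1 = n) (j : ℕ) (A : Finset (Fin n))
    (hA : A.card = j) (hA2 : ¬ (a ∈ A ∨ b ∈ A)) (β : Fin n → Fin n) (ε : Bool) (g : Fin n → Perm (Fin n))
    (hg : ∀ i, (g i i = a ∨ g i i = b)) (hg2 : ∀ i x, x ≠ a → x ≠ b → x ≠ i → g i x = x)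
    (hs : ∀ i < a, (g i).IsThreeCycle) :
    ∑ i ∈ Finset.Iio a, RR n (g i) (fA A β ε) - ((n : ℝ) - 2 - j) • fA A β ε
      ∈ Submodule.span ℝ (GS (BS a b j) : Set (EE n)) := by
  push Not at hA2
  have hsub : A ⊆ Finset.Iio a := by
    intro x hx
    rw [Finset.mem_Iio, Fin.lt_def]
    have h1 : (x : ℕ) ≠ a := fun h => hA2.1 (by rwa [← Fin.ext h])
    have h2 : (x : ℕ) ≠ b := fun h => hA2.2 (by rwa [← Fin.ext h])
    omega
  have hfix : ∀ i ∈ Finset.Iio a \ A, RR n (g i) (fA A β ε) = fA A β ε := by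
    intro i hi
    rw [Finset.mem_sdiff, Finset.mem_Iio] at hi
    ext σ
    rw [RR_apply, fA_apply, fA_apply]
    have h1 : (∀ x ∈ A, (σ * g i) x = β x) ↔ (∀ x ∈ A, σ x = β x) := by
      refine forall₂_congr fun x hx => ?_
      rw [Perm.mul_apply, hg2 i x]
      · rintro rfl; exact hA2.1 hx
      · rintro rfl; exact hA2.2 hx
      · rintro rfl; exact hi.2 hx
    have h2 : sg ε (g i) = 1 := by
      unfold sg; rw [(hs i hi.1).sign]; simp
    simp only [h1, sg_mul, h2, mul_one]
  have hcard : ((Finset.Iio a \ A).card : ℝ) = (n : ℝ) - 2 - j := by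
    have h1 := Finset.card_sdiff_add_card_eq_card hsub
    rw [Fin.card_Iio, hA] at h1
    have h2 : (n : ℝ) = ((Finset.Iio a \ A).card + j + 2 : ℕ) := by rw [h1, ha]
    rw [h2]; push_cast; ring
  rw [← Finset.sum_sdiff hsub, Finset.sum_congr rfl hfix, Finset.sum_const, ← hcard, Nat.cast_smul_eq_nsmul,
    add_sub_cancel_left]
  refine Submodule.sum_mem _ fun i hi => ?_
  rw [RR_fA]
  refine Submodule.smul_mem _ _ (GS_mem _ _ ?_ _ _)
  rw [BS, Finset.mem_filter, Finset.mem_powersetCard]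
  refine ⟨⟨Finset.subset_univ _, by rw [Finset.card_image_of_injective _ (g i).injective, hA]⟩, ?_⟩
  rcases hg i with h | h
  · left; rw [← h]; exact Finset.mem_image_of_mem _ hi
  · right; rw [← h]; exact Finset.mem_image_of_mem _ hi

theorem finrank_map (j : ℕ) (hj : j + 2 ≤ n) : (n : ℝ) * Module.finrank ℝ ((VV n j).map
    (CC (Pmeas n) - ((2 * ((n : ℝ) - j) - 3) / (2 * n - 3)) • (1 : Module.End ℝ (EE n)))) ≤ 8 * (n : ℝ) ^ (2 * j) := by
  set a : Fin n := ⟨n - 2, by omega⟩ with ha'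
  set b : Fin n := ⟨n - 1, by omega⟩ with hb'
  have ha : (a : ℕ) + 2 = n := by simp [ha']; omega
  have hb : (b : ℕ) + 1 = n := by simp [hb']; omega
  have hab : a < b := by rw [Fin.lt_def]; omega
  have hn : (2 : ℝ) * n - 3 ≠ 0 := by
    have : (2 : ℝ) ≤ n := by exact_mod_cast (by omega : 2 ≤ n)
    linarith
  set A0 := CC (Pmeas n) - ((2 * ((n : ℝ) - j) - 3) / (2 * n - 3)) • (1 : Module.End ℝ (EE n)) with hA0
  have hinv : ∀ {U : Submodule ℝ (EE n)}, RInv U → ∀ v ∈ U, A0 v ∈ U := by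
    intro U hU v hv
    rw [hA0, LinearMap.sub_apply, LinearMap.smul_apply]
    exact U.sub_mem (hU.CC _ v hv) (U.smul_mem _ hv)
  set Y := Submodule.span ℝ (GS (BS a b j) : Set (EE n)) with hY
  have h1 : (VV n j).map A0 ≤ II n j ⊔ (Y ⊔ Y.map A0) := by
    refine (Submodule.map_mono inf_le_left).trans ?_
    rw [II, Submodule.map_span_le]
    rintro f ⟨A, β, ε, hA, rfl⟩
    rcases Nat.lt_succ_iff_lt_or_eq.1 hA with h | h
    · exact Submodule.mem_sup_left (hinv (II_RInv j) _ (fA_mem h β ε))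
    apply Submodule.mem_sup_right
    by_cases hbad : a ∈ A ∨ b ∈ A
    · apply Submodule.mem_sup_right
      apply Submodule.mem_map_of_mem
      exact GS_mem _ _ (by simp [BS, Finset.mem_powersetCard, h, hbad]) _ _
    · apply Submodule.mem_sup_left
      have e1 := three_sum a b ha hb j A h hbad β ε (fun i => if i < a then swap i a * swap a b else swap i a) ?_ ?_ ?_
      have e2 := three_sum a b ha hb j A h hbad β ε (fun i => if i < a then swap i b * swap a b else swap i b) ?_ ?_ ?_
      · have e3 := Y.smul_mem (1 / (2 * (n : ℝ) - 3)) (Y.add_mem e1 e2)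
        convert e3 using 1
        rw [hA0, LinearMap.sub_apply, LinearMap.smul_apply, P_fA a b ha hb]
        have c1 : ∑ i ∈ Finset.Iio a, RR n (if i < a then swap i a * swap a b else swap i a) (fA A β ε)
            = ∑ i ∈ Finset.Iio a, RR n (swap i a * swap a b) (fA A β ε) :=
          Finset.sum_congr rfl fun i hi => by rw [if_pos (Finset.mem_Iio.1 hi)]
        have c2 : ∑ i ∈ Finset.Iio a, RR n (if i < a then swap i b * swap a b else swap i b) (fA A β ε)
            = ∑ i ∈ Finset.Iio a, RR n (swap i b * swap a b) (fA A β ε) :=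
          Finset.sum_congr rfl fun i hi => by rw [if_pos (Finset.mem_Iio.1 hi)]
        rw [c1, c2, Module.End.one_apply]
        have : (2 * ((n : ℝ) - j) - 3) / (2 * n - 3) = (1 / (2 * (n : ℝ) - 3)) * (2 * ((n : ℝ) - j) - 3) := by
          field_simp
        rw [this]
        module
      · intro i
        split_ifs with hi
        · right; rw [Perm.mul_apply, swap_apply_of_ne_of_ne hi.ne (hi.trans hab).ne, swap_apply_left]
        · right; rw [swap_apply_left]
      · intro i x h1 h2 h3
        split_ifs with hi
        · rw [Perm.mul_apply, swap_apply_of_ne_of_ne h1 h2, swap_apply_of_ne_of_ne h3 h2]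
        · rw [swap_apply_of_ne_of_ne h3 h2]
      · intro i hi
        rw [if_pos hi, swap_comm i b, swap_comm a b]
        exact Perm.isThreeCycle_swap_mul_swap_same (hi.trans hab).ne' hab.ne' hi.ne
      · intro i
        split_ifs with hi
        · left; rw [Perm.mul_apply, swap_apply_of_ne_of_ne hi.ne (hi.trans hab).ne, swap_apply_left]
        · left; rw [swap_apply_left]
      · intro i x h1 h2 h3
        split_ifs with hi
        · rw [Perm.mul_apply, swap_apply_of_ne_of_ne h1 h2, swap_apply_of_ne_of_ne h3 h1]
        · rw [swap_apply_of_ne_of_ne h3 h1]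
      · intro i hi
        rw [if_pos hi, swap_comm i a]
        exact Perm.isThreeCycle_swap_mul_swap_same hi.ne' hab.ne (hi.trans hab).ne
  have h2 : (VV n j).map A0 ≤ (II n j)ᗮ := by
    rintro x ⟨v, hv, rfl⟩
    exact hinv (II_RInv j).orth _ hv.2
  have h3 := finrank_le_of_orth _ _ _ h1 h2
  have h4 : Module.finrank ℝ Y ≤ (BS a b j).card * (n ^ j * 2) :=
    (finrank_span_finset_le_card _).trans (GS_card _ j (fun A hA => by
      rw [BS, Finset.mem_filter, Finset.mem_powersetCard] at hA; exact hA.1.2))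
  have h5 : Module.finrank ℝ (Y ⊔ Y.map A0 : Submodule ℝ (EE n)) ≤ Module.finrank ℝ Y + Module.finrank ℝ (Y.map A0) :=
    Submodule.finrank_add_le_finrank_add_finrank _ _
  have h6 : Module.finrank ℝ (Y.map A0) ≤ Module.finrank ℝ Y := Submodule.finrank_map_le _ _
  have h7 := BS_card a b j
  have h8 : n * Module.finrank ℝ ((VV n j).map A0) ≤ 8 * n ^ (2 * j) := by
    calc n * Module.finrank ℝ ((VV n j).map A0) ≤ n * (2 * ((BS a b j).card * (n ^ j * 2))) :=
          Nat.mul_le_mul_left _ (by omega)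
      _ = (n * (BS a b j).card) * (4 * n ^ j) := by ring
      _ ≤ (2 * n ^ j) * (4 * n ^ j) := Nat.mul_le_mul_right _ h7
      _ = 8 * n ^ (2 * j) := by ring
  exact_mod_cast h8

/-- the Hilbert-Schmidt sums -/
noncomputable def SS (n j k l : ℕ) : ℝ :=
  ∑ τ : Perm (Fin n), ‖(CC (Qmeas n) ^ k - CC (Pmeas n) ^ l) ((VV n j).starProjection (eb n τ))‖ ^ 2

theorem Epow_mem {U : Submodule ℝ (EE n)} (T : Module.End ℝ (EE n)) (h : ∀ v ∈ U, T v ∈ U) (k : ℕ) :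
    ∀ v ∈ U, (T ^ k) v ∈ U := by
  induction k with
  | zero => intro v hv; simpa using hv
  | succ k ih => intro v hv; rw [pow_succ, Module.End.mul_apply]; exact ih _ (h v hv)

theorem total_eq (k l : ℕ) : ((n.factorial : ℝ) / 2) * ∑ σ : alternatingGroup (Fin n),
      (convPow (Qmeas n) k σ - convPow (Pmeas n) l σ) ^ 2 = (∑ j ∈ Finset.range (n + 1), SS n j k l) / 2 := by
  have h1 := CC_hs (fun g => convPow (Qmeas n) k g - convPow (Pmeas n) l g)
  rw [CC_sub, CC_pow, CC_pow] at h1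
  have h2 : ∀ τ : Perm (Fin n), ‖(CC (Qmeas n) ^ k - CC (Pmeas n) ^ l) (eb n τ)‖ ^ 2 =
      ∑ j ∈ Finset.range (n + 1), ‖(CC (Qmeas n) ^ k - CC (Pmeas n) ^ l) ((VV n j).starProjection (eb n τ))‖ ^ 2 := by
    intro τ
    have hT : ∀ {U : Submodule ℝ (EE n)}, RInv U → ∀ v ∈ U, (CC (Qmeas n) ^ k - CC (Pmeas n) ^ l) v ∈ U := by
      intro U hU v hv
      rw [LinearMap.sub_apply]
      exact U.sub_mem (Epow_mem _ (hU.CC _) _ v hv) (Epow_mem _ (hU.CC _) _ v hv)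
    have := hs_filtration (II n) II_mono II_zero (CC (Qmeas n) ^ k - CC (Pmeas n) ^ l)
      (fun j => hT (II_RInv j)) (fun j => hT (II_RInv j).orth) (n + 1) (eb n τ)
    refine Eq.trans ?_ this
    congr 3
    exact (Submodule.starProjection_eq_self_iff.2 (by rw [II_top]; trivial)).symm
  simp only [h2] at h1
  rw [Finset.sum_comm] at h1
  unfold SS
  rw [h1]; ring

theorem SS_zero (j k l : ℕ) (hn : 2 ≤ n) (hj : n < j + 2) : SS n j k l = 0 := by
  have : VV n j = ⊥ := by
    rw [eq_bot_iff]
    intro v hv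
    by_contra hc
    have := VV_nonzero j hn v hv hc
    omega
  have h2 : ∀ x : EE n, (VV n j).starProjection x = 0 := by
    intro x
    have h3 := (VV n j).starProjection_apply_mem x
    generalize (VV n j).starProjection x = y at h3
    rw [this] at h3
    simpa using h3
  unfold SS
  simp only [h2, map_zero]
  simp

theorem CCQ_symm : (CC (Qmeas n)).IsSymmetric := by
  rw [CC_Q]
  intro x y
  simp only [LinearMap.smul_apply, inner_smul_left, inner_smul_right, S3_symm x y]
  simp

theorem T_bound (j k l : ℕ) (hj : j + 2 ≤ n) (qb : ℝ) (hq0 : 0 ≤ qb)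
    (hq : ∀ q, EigIn (VV n j) (CC (Qmeas n)) q → |q| ≤ qb) (u : EE n) (hu : u ∈ VV n j) :
    ‖(CC (Qmeas n) ^ k - CC (Pmeas n) ^ l) u‖ ^ 2 ≤
      (2 * (qb ^ (2 * k) + ((2 * ((n : ℝ) - j) - 3) / (2 * n - 3)) ^ (2 * l))) * ‖u‖ ^ 2 := by
  have h1 := spectral_norm_le (VV n j) (CC (Qmeas n)) CCQ_symm ((VV_RInv j).CC _) k 0 (qb ^ k) (by positivity)
    (fun a ha => by
      rw [sub_zero, abs_pow]; exact pow_le_pow_left₀ (abs_nonneg _) (hq a ha) k) u hu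
  rw [zero_smul, sub_zero] at h1
  have h2 := P_pow_bound j hj l u hu
  set p := (2 * ((n : ℝ) - j) - 3) / (2 * n - 3)
  rw [LinearMap.sub_apply]
  have h3 := norm_sub_le ((CC (Qmeas n) ^ k) u) ((CC (Pmeas n) ^ l) u)
  have h4 : ‖(CC (Qmeas n) ^ k) u - (CC (Pmeas n) ^ l) u‖ ≤ qb ^ k * ‖u‖ + p ^ l * ‖u‖ := by linarith
  calc _ ≤ (qb ^ k * ‖u‖ + p ^ l * ‖u‖) ^ 2 := pow_le_pow_left₀ (norm_nonneg _) h4 2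
    _ ≤ 2 * ((qb ^ k) ^ 2 + (p ^ l) ^ 2) * ‖u‖ ^ 2 := by nlinarith [sq_nonneg (qb ^ k * ‖u‖ - p ^ l * ‖u‖)]
    _ = _ := by rw [← pow_mul, ← pow_mul, mul_comm k, mul_comm l]

theorem SS_bound1 (j k l : ℕ) (hj : j + 2 ≤ n) (qb : ℝ) (hq0 : 0 ≤ qb)
    (hq : ∀ q, EigIn (VV n j) (CC (Qmeas n)) q → |q| ≤ qb) :
    SS n j k l ≤ (2 * (qb ^ (2 * k) + ((2 * ((n : ℝ) - j) - 3) / (2 * n - 3)) ^ (2 * l))) *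
      (n.choose j * (n ^ j * 2)) := by
  refine (hs_bound (eb n) (VV n j) _ _ (T_bound j k l hj qb hq0 hq)).trans ?_
  apply mul_le_mul_of_nonneg_left
  · exact_mod_cast finrank_VV j
  · have : ((2 * ((n : ℝ) - j) - 3) / (2 * n - 3)) ^ (2 * l) = (((2 * ((n : ℝ) - j) - 3) / (2 * n - 3)) ^ l) ^ 2 := by
      rw [← pow_mul, mul_comm l]
    rw [this]; positivity

theorem SS_bound2 (j k l : ℕ) (hj : j + 2 ≤ n) (qb M : ℝ) (hq0 : 0 ≤ qb)
    (hq : ∀ q, EigIn (VV n j) (CC (Qmeas n)) q → |q| ≤ qb) (hM0 : 0 ≤ M)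
    (hM : ∀ q, EigIn (VV n j) (CC (Qmeas n)) q → |q ^ k - ((2 * ((n : ℝ) - j) - 3) / (2 * n - 3)) ^ l| ≤ M) :
    SS n j k l ≤ 2 * (M ^ 2 * (n.choose j * (n ^ j * 2))) + 2 * (
     (2 * (qb ^ (2 * k) + ((2 * ((n : ℝ) - j) - 3) / (2 * n - 3)) ^ (2 * l))) *
      (8 * (n : ℝ) ^ (2 * j) / n)) := by
  set p := (2 * ((n : ℝ) - j) - 3) / (2 * n - 3) with hp
  set A0 := CC (Pmeas n) - p • (1 : Module.End ℝ (EE n)) with hA0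
  have hn : (0 : ℝ) < n := by exact_mod_cast (by omega : 0 < n)
  refine (hs_bound_split (eb n) (VV n j) (VV n j ⊓ LinearMap.ker A0) inf_le_left _ (M ^ 2) _ ?_
    (T_bound j k l hj qb hq0 hq)).trans ?_
  · rintro u ⟨hu, huk⟩
    have h1 : CC (Pmeas n) u = p • u := by
      have : A0 u = 0 := huk
      rw [hA0, LinearMap.sub_apply, LinearMap.smul_apply, Module.End.one_apply, sub_eq_zero] at this
      exact this
    have h2 : (CC (Pmeas n) ^ l) u = p ^ l • u := by
      clear hM
      induction l with
      | zero => simp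
      | succ l ih => rw [pow_succ, Module.End.mul_apply, h1, map_smul, ih, smul_smul, pow_succ, mul_comm]
    rw [LinearMap.sub_apply, h2, ← mul_pow]
    exact pow_le_pow_left₀ (norm_nonneg _) (spectral_norm_le (VV n j) (CC (Qmeas n)) CCQ_symm ((VV_RInv j).CC _) k
      (p ^ l) M hM0 hM u hu) 2
  · rw [finrank_compl_ker, ← hp]
    have hpp : 0 ≤ p ^ (2 * l) := by
      rw [mul_comm, pow_mul]; positivity
    apply add_le_add
    · apply mul_le_mul_of_nonneg_left _ (by norm_num)
      apply mul_le_mul_of_nonneg_left _ (by positivity)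
      have h1 : Module.finrank ℝ (VV n j ⊓ LinearMap.ker A0 : Submodule ℝ (EE n)) ≤ n.choose j * (n ^ j * 2) :=
        (Submodule.finrank_mono inf_le_left).trans (finrank_VV j)
      exact_mod_cast h1
    · apply mul_le_mul_of_nonneg_left _ (by norm_num)
      apply mul_le_mul_of_nonneg_left _ (by positivity)
      rw [le_div_iff₀ hn, mul_comm]
      exact finrank_map j hj
end Dim

section Eig
open Equiv
variable {n : ℕ}

theorem S3_of_Q (hn : 3 ≤ n) (U : Submodule ℝ (EE n)) (q : ℝ) (h : EigIn U (CC (Qmeas n)) q) :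
    EigIn U (S3 n) (q * ((n : ℝ) * (n - 1) * (n - 2)) / 3) := by
  obtain ⟨v, hv, hv0, h⟩ := h
  have hn' : (3 : ℝ) ≤ n := by exact_mod_cast hn
  have h1 : (n : ℝ) ≠ 0 := by linarith
  have h2 : (n : ℝ) - 1 ≠ 0 := by linarith
  have h3 : (n : ℝ) - 2 ≠ 0 := by linarith
  refine ⟨v, hv, hv0, ?_⟩
  rw [CC_Q, LinearMap.smul_apply] at h
  have := congrArg (fun w => (((n : ℝ) * (n - 1) * (n - 2)) / 3) • w) h
  simp only [smul_smul] at this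
  rw [show (n : ℝ) * (n - 1) * (n - 2) / 3 * (3 / (n * (n - 1) * (n - 2))) = 1 by field_simp, one_smul] at this
  rw [this]; congr 1; ring

theorem q_bounds (hn : 3 ≤ n) (j : ℕ) (hj : j + 2 ≤ n) (q : ℝ) (h : EigIn (VV n j) (CC (Qmeas n)) q) :
    q ≤ 1 - 3 * j * (n - 1 - j) / (((n : ℝ) - 1) * (n - 2)) ∧
    1 - (3 * j * (n - 1 - j) / (((n : ℝ) - 1) * (n - 2)) + j * (j + 1) * (2 * j + 1) / (2 * n * (n - 1) * (n - 2))) ≤ q ∧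
    - (3 / (2 * ((n : ℝ) - 2))) ≤ q ∧
    q ≤ (3 * ((n : ℝ) - 1 - j) ^ 2 - 3 * (n - 1) / 2) / ((n - 1) * (n - 2)) := by
  have hn' : (3 : ℝ) ≤ n := by exact_mod_cast hn
  have h1 : 0 < (n : ℝ) := by linarith
  have h2 : 0 < (n : ℝ) - 1 := by linarith
  have h3 : 0 < (n : ℝ) - 2 := by linarith
  have hS := S3_of_Q hn _ q h
  obtain ⟨a1, a2⟩ := S3_bound_W j (by omega) _ hS
  obtain ⟨b1, b2⟩ := S3_bound_all j hj _ hS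
  have hN : 0 < (n : ℝ) * (n - 1) * (n - 2) := by positivity
  refine ⟨?_, ?_, ?_, ?_⟩
  · have e : 1 - 3 * j * (n - 1 - j) / (((n : ℝ) - 1) * (n - 2)) =
        (3 * (((n : ℝ) - j - 1) * (n - j) * (2 * (n - j) - 1) / 6
      + (j : ℝ) * (j + 1) * (2 * j + 1) / 6 - (n : ℝ) * (n - 1) / 2)) / ((n : ℝ) * (n - 1) * (n - 2)) := by
      field_simp; ring
    rw [e, le_div_iff₀ hN]; linarith
  · have e : 1 - (3 * j * (n - 1 - j) / (((n : ℝ) - 1) * (n - 2)) + j * (j + 1) * (2 * j + 1) / (2 * n * (n - 1) * (n - 2))) =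
        (3 * (((n : ℝ) - j - 1) * (n - j) * (2 * (n - j) - 1) / 6 - (n : ℝ) * (n - 1) / 2)) / ((n : ℝ) * (n - 1) * (n - 2)) := by
      field_simp; ring
    rw [e, div_le_iff₀ hN]; linarith
  · have e : - (3 / (2 * ((n : ℝ) - 2))) = (3 * (- ((n : ℝ) * (n - 1) / 2))) / ((n : ℝ) * (n - 1) * (n - 2)) := by
      field_simp
    rw [e, div_le_iff₀ hN]; linarith
  · have e : (3 * ((n : ℝ) - 1 - j) ^ 2 - 3 * (n - 1) / 2) / ((n - 1) * (n - 2)) =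
       (3 * ((n : ℝ) * ((n : ℝ) - j - 1) ^ 2 - (n : ℝ) * (n - 1) / 2)) / ((n : ℝ) * (n - 1) * (n - 2)) := by
      field_simp; ring
    rw [e, le_div_iff₀ hN]; linarith

theorem exp_lem1 (x : ℝ) (h0 : 0 ≤ x) (h1 : x ≤ 1) : 1 - x + x ^ 2 / 2 - x ^ 3 / 6 ≤ Real.exp (-x) := by
  have := Real.exp_bound (x := -x) (by rw [abs_neg, abs_of_nonneg h0]; exact h1) (n := 5) (by norm_num)
  rw [abs_neg, abs_of_nonneg h0] at this
  have := (abs_le.1 this).1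
  simp [Finset.sum_range_succ, Nat.factorial] at this
  have h4 : 0 ≤ x ^ 4 * (1 - x) := mul_nonneg (by positivity) (by linarith)
  have h5 : 0 ≤ x ^ 4 := by positivity
  have h6 : 0 ≤ x ^ 5 := by positivity
  nlinarith

theorem exp_lem2 : 1 / 3 ≤ Real.exp (-(16 / 15)) := by
  rw [Real.exp_neg, one_div]
  apply inv_anti₀ (Real.exp_pos _)
  have h1 : Real.exp (16 / 15) ^ 15 ≤ 3 ^ 15 := by
    rw [← Real.exp_nat_mul]
    have : ((15 : ℕ) : ℝ) * (16 / 15) = (16 : ℕ) * 1 := by norm_num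
    rw [this, Real.exp_nat_mul]
    calc Real.exp 1 ^ 16 ≤ 2.7183 ^ 16 := pow_le_pow_left₀ (Real.exp_pos _).le (by linarith [Real.exp_one_lt_d9]) _
      _ ≤ 3 ^ 15 := by norm_num
  exact le_of_pow_le_pow_left₀ (by norm_num) (by norm_num) h1

theorem exp_lem3 : 3 / 16 ≤ Real.exp (-(8 / 5)) := by
  rw [Real.exp_neg]
  rw [show (3 / 16 : ℝ) = (16 / 3)⁻¹ by norm_num]
  apply inv_anti₀ (Real.exp_pos _)
  have h1 : Real.exp (8 / 5) ^ 5 ≤ (16 / 3) ^ 5 := by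
    rw [← Real.exp_nat_mul]
    have : ((5 : ℕ) : ℝ) * (8 / 5) = (8 : ℕ) * 1 := by norm_num
    rw [this, Real.exp_nat_mul]
    calc Real.exp 1 ^ 8 ≤ 2.7183 ^ 8 := pow_le_pow_left₀ (Real.exp_pos _).le (by linarith [Real.exp_one_lt_d9]) _
      _ ≤ _ := by norm_num
  exact le_of_pow_le_pow_left₀ (by norm_num) (by norm_num) h1

theorem q_exp (y q : ℝ) (h0 : 0 ≤ y) (h1 : y ≤ 1) (hq1 : q ≤ 1 - 3 * y + 3 * y ^ 2)
    (hq2 : 2 / 3 ≤ y → q ≤ 3 * (1 - y) ^ 2) (hq3 : -(3 / 16) ≤ q) :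
    (y ≤ 1 / 3 → |q| ≤ Real.exp (-(3 * y))) ∧ (1 / 3 ≤ y → |q| ≤ Real.exp (-(8 / 5 * y))) := by
  constructor
  · intro hy
    have e := exp_lem1 (3 * y) (by linarith) (by linarith)
    have e2 : 0 ≤ y ^ 2 * (1 - 3 * y) := mul_nonneg (by positivity) (by linarith)
    have e3 : 1 - 3 * y + 3 * y ^ 2 ≤ Real.exp (-(3 * y)) := by nlinarith
    rw [abs_le]
    constructor
    · nlinarith [sq_nonneg (y - 1 / 2)]
    · linarith
  · intro hy
    have e3 : 3 / 16 ≤ Real.exp (-(8 / 5 * y)) := exp_lem3.trans (Real.exp_le_exp.2 (by linarith))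
    rw [abs_le]
    refine ⟨by linarith, ?_⟩
    rcases le_total y (2 / 3) with hy2 | hy2
    · have : 1 / 3 ≤ Real.exp (-(8 / 5 * y)) := exp_lem2.trans (Real.exp_le_exp.2 (by linarith))
      nlinarith
    · have e1 := hq2 hy2
      have e2 : Real.exp (-(8 / 5 * y)) = Real.exp (-(16 / 15)) * Real.exp (-(8 / 5 * (y - 2 / 3))) := by
        rw [← Real.exp_add]; congr 1; ring
      have e4 := Real.add_one_le_exp (-(8 / 5 * (y - 2 / 3)))
      have e5 : 1 / 3 * (-(8 / 5 * (y - 2 / 3)) + 1) ≤ Real.exp (-(8 / 5 * y)) := by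
        rw [e2]
        exact mul_le_mul exp_lem2 e4 (by linarith) (Real.exp_pos _).le
      nlinarith

theorem q_final (hn : 10 ≤ n) (j : ℕ) (hj : j + 2 ≤ n) (q : ℝ) (h : EigIn (VV n j) (CC (Qmeas n)) q) :
    ((j : ℝ) / (n - 1) ≤ 1 / 3 → |q| ≤ Real.exp (-(3 * ((j : ℝ) / (n - 1))))) ∧
    (1 / 3 ≤ (j : ℝ) / (n - 1) → |q| ≤ Real.exp (-(8 / 5 * ((j : ℝ) / (n - 1))))) := by
  have hn' : (10 : ℝ) ≤ n := by exact_mod_cast hn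
  have hj' : (j : ℝ) + 2 ≤ n := by exact_mod_cast hj
  have hj0 : (0 : ℝ) ≤ j := Nat.cast_nonneg _
  have h2 : 0 < (n : ℝ) - 1 := by linarith
  have h3 : 0 < (n : ℝ) - 2 := by linarith
  obtain ⟨a1, -, a3, a4⟩ := q_bounds (by omega) j hj q h
  have hy0 : 0 ≤ (j : ℝ) / (n - 1) := by positivity
  have hy1 : (j : ℝ) / (n - 1) ≤ 1 := by rw [div_le_one h2]; linarith
  obtain ⟨y, hy⟩ : ∃ y, y = (j : ℝ) / (n - 1) := ⟨_, rfl⟩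
  have hjy : (j : ℝ) = y * (n - 1) := by rw [hy]; field_simp
  rw [← hy] at hy0 hy1 ⊢
  rw [hjy] at a1 a4
  refine q_exp y q hy0 hy1 ?_ ?_ ?_
  · have e : 1 - 3 * (y * ((n : ℝ) - 1)) * (n - 1 - y * (n - 1)) / ((n - 1) * (n - 2)) =
      1 - 3 * (y * (1 - y)) * ((n - 1) / (n - 2)) := by field_simp
    rw [e] at a1
    have e2 : 1 ≤ ((n : ℝ) - 1) / (n - 2) := by rw [one_le_div h3]; linarith
    have e3 : 0 ≤ y * (1 - y) := mul_nonneg hy0 (by linarith)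
    nlinarith
  · intro hy2
    refine a4.trans ?_
    have e : (3 * ((n : ℝ) - 1 - y * (n - 1)) ^ 2 - 3 * (n - 1) / 2) / ((n - 1) * (n - 2)) =
      (3 * (n - 1) * (1 - y) ^ 2 - 3 / 2) / (n - 2) := by field_simp
    rw [e, div_le_iff₀ h3]
    have : (1 - y) ^ 2 ≤ 1 / 2 := by nlinarith
    nlinarith
  · refine le_trans ?_ a3
    rw [neg_le_neg_iff, div_le_div_iff₀ (by linarith) (by norm_num)]
    linarith
end Eig

noncomputable def kk (c : ℝ) (n : ℕ) : ℕ := ⌈((n : ℝ) / 3) * (Real.log n + c)⌉₊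
noncomputable def ll (c : ℝ) (n : ℕ) : ℕ := ⌈((n : ℝ) - 3 / 2) * (Real.log n + c)⌉₊

theorem kk_ge (c : ℝ) (n : ℕ) : ((n : ℝ) / 3) * (Real.log n + c) ≤ kk c n := Nat.le_ceil _
theorem ll_ge (c : ℝ) (n : ℕ) : ((n : ℝ) - 3 / 2) * (Real.log n + c) ≤ ll c n := Nat.le_ceil _

theorem pow_est {b y t : ℝ} (m : ℕ) (h0 : 0 ≤ b) (hb : b ≤ Real.exp (-y)) (ht : t ≤ y * m) :
    b ^ m ≤ Real.exp (-t) := by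
  calc b ^ m ≤ Real.exp (-y) ^ m := pow_le_pow_left₀ h0 hb m
    _ = Real.exp (m * (-y)) := (Real.exp_nat_mul _ _).symm
    _ ≤ _ := Real.exp_le_exp.mpr (by linarith)

theorem npow_exp (n m : ℕ) (hn : 1 ≤ n) : (n : ℝ) ^ m = Real.exp (m * Real.log n) := by
  rw [Real.exp_nat_mul, Real.exp_log (by exact_mod_cast hn)]

theorem mul_est (c : ℝ) (n j : ℕ) (hn : 1 ≤ n) (z : ℝ) (hz : z ≤ Real.exp (-(2 * j * (Real.log n + c)))) :
    (n : ℝ) ^ (2 * j) * z ≤ Real.exp (-(2 * c)) ^ j := by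
  rw [npow_exp _ _ hn, ← Real.exp_nat_mul]
  calc _ ≤ Real.exp (((2 * j : ℕ) : ℝ) * Real.log n) * Real.exp (-(2 * j * (Real.log n + c))) :=
        mul_le_mul_of_nonneg_left hz (Real.exp_pos _).le
    _ = _ := by rw [← Real.exp_add]; congr 1; push_cast; ring

theorem p_props (n j : ℕ) (hn : 10 ≤ n) (hj : j + 2 ≤ n) :
    0 ≤ (2 * ((n : ℝ) - j) - 3) / (2 * n - 3) ∧
    (2 * ((n : ℝ) - j) - 3) / (2 * n - 3) = 1 - 2 * j / (2 * n - 3) := by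
  have hn' : (10 : ℝ) ≤ n := by exact_mod_cast hn
  have hj' : (j : ℝ) + 2 ≤ n := by exact_mod_cast hj
  have h : 0 < 2 * (n : ℝ) - 3 := by linarith
  constructor
  · apply div_nonneg <;> linarith
  · field_simp; ring

theorem p_est (c : ℝ) (n j : ℕ) (hn : 10 ≤ n) (hj : j + 2 ≤ n) :
    (n : ℝ) ^ (2 * j) * ((2 * ((n : ℝ) - j) - 3) / (2 * n - 3)) ^ (2 * ll c n) ≤ Real.exp (-(2 * c)) ^ j := by
  obtain ⟨h0, h1⟩ := p_props n j hn hj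
  have hn' : (10 : ℝ) ≤ n := by exact_mod_cast hn
  have h : 0 < 2 * (n : ℝ) - 3 := by linarith
  apply mul_est _ _ _ (by omega)
  apply pow_est (y := 2 * j / (2 * n - 3)) _ h0
  · rw [h1]; have := Real.add_one_le_exp (-(2 * (j : ℝ) / (2 * n - 3))); linarith
  · have := mul_le_mul_of_nonneg_left (ll_ge c n) (show 0 ≤ 4 * (j : ℝ) / (2 * n - 3) by positivity)
    calc 2 * j * (Real.log n + c) = 4 * (j : ℝ) / (2 * n - 3) * (((n : ℝ) - 3 / 2) * (Real.log n + c)) := by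
          field_simp; ring
      _ ≤ _ := this
      _ = _ := by push_cast; ring

theorem k_est (c : ℝ) (n j : ℕ) (hn : 10 ≤ n) (hL : 0 ≤ Real.log n + c) :
    (j : ℝ) * (Real.log n + c) / 3 ≤ (j : ℝ) / (n - 1) * kk c n := by
  have hn' : (10 : ℝ) ≤ n := by exact_mod_cast hn
  have h : 0 < (n : ℝ) - 1 := by linarith
  have := mul_le_mul_of_nonneg_left (kk_ge c n) (show 0 ≤ (j : ℝ) / (n - 1) by positivity)
  refine le_trans ?_ this
  rw [div_mul_eq_mul_div, le_div_iff₀ h]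
  have : 0 ≤ (j : ℝ) * (Real.log n + c) := by positivity
  nlinarith

theorem q_est1 (c : ℝ) (n j : ℕ) (hn : 10 ≤ n) (hL : 0 ≤ Real.log n + c) :
    (n : ℝ) ^ (2 * j) * (Real.exp (-(3 * ((j : ℝ) / (n - 1))))) ^ (2 * kk c n) ≤ Real.exp (-(2 * c)) ^ j := by
  apply mul_est _ _ _ (by omega)
  apply pow_est (y := 3 * ((j : ℝ) / (n - 1))) _ (Real.exp_pos _).le le_rfl
  have := k_est c n j hn hL
  push_cast; linarith

theorem q_est2 (c : ℝ) (n j : ℕ) (hn : 10 ≤ n) (hL : 0 ≤ Real.log n + c)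
    (hX : 6 * Real.exp 1 * (Real.exp (-(16 / 15 * c)) * Real.exp (-(1 / 15 * Real.log n))) ≤ 1 / 2)
    (hj : 1 / 3 ≤ (j : ℝ) / (n - 1)) :
    (n : ℝ) ^ (2 * j) * (Real.exp (-(8 / 5 * ((j : ℝ) / (n - 1))))) ^ (2 * kk c n) / j.factorial ≤ (1 / 2) ^ j := by
  have hn' : (10 : ℝ) ≤ n := by exact_mod_cast hn
  have h : 0 < (n : ℝ) - 1 := by linarith
  have hj2 : ((n : ℝ) - 1) / 3 ≤ j := by
    rw [le_div_iff₀ h] at hj; linarith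
  have hj0 : (0 : ℝ) < j := by linarith
  have h1 : (Real.exp (-(8 / 5 * ((j : ℝ) / (n - 1))))) ^ (2 * kk c n) ≤ Real.exp (-(j * (16 / 15 * (Real.log n + c)))) := by
    apply pow_est (y := 8 / 5 * ((j : ℝ) / (n - 1))) _ (Real.exp_pos _).le le_rfl
    have := k_est c n j hn hL
    push_cast; linarith
  set X : ℝ := n * (Real.exp (-(16 / 15 * c)) * Real.exp (-(1 / 15 * Real.log n))) with hXd
  have hX0 : 0 ≤ X := by positivity
  have h2 : (n : ℝ) ^ (2 * j) * Real.exp (-(j * (16 / 15 * (Real.log n + c)))) = X ^ j := by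
    have : X = Real.exp (Real.log n + (-(16 / 15 * c) + -(1 / 15 * Real.log n))) := by
      rw [Real.exp_add, Real.exp_add, Real.exp_log (by linarith)]
    rw [this, npow_exp _ _ (by omega), ← Real.exp_add, ← Real.exp_nat_mul]
    congr 1; push_cast; ring
  have h3 := Real.pow_div_factorial_le_exp (j : ℝ) hj0.le j
  have hf : (0 : ℝ) < j.factorial := by exact_mod_cast j.factorial_pos
  have h4 : X ^ j / j.factorial ≤ (X * Real.exp 1 / j) ^ j := by
    rw [div_pow, mul_pow X (Real.exp 1), ← Real.exp_nat_mul, mul_one, div_le_div_iff₀ hf (by positivity)]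
    rw [div_le_iff₀ hf] at h3
    nlinarith [pow_nonneg hX0 j]
  calc _ ≤ X ^ j / j.factorial := by
        rw [← h2]; gcongr
    _ ≤ _ := h4
    _ ≤ _ := by
      apply pow_le_pow_left₀ (by positivity)
      rw [div_le_iff₀ hj0]
      have e0 : (n : ℝ) ≤ 6 * j := by linarith
      have e1 : 0 ≤ Real.exp (-(16 / 15 * c)) * Real.exp (-(1 / 15 * Real.log n)) * Real.exp 1 := by positivity
      have e2 := mul_le_mul_of_nonneg_right e0 e1
      have e3 := mul_le_mul_of_nonneg_right hX hj0.le
      rw [hXd]; nlinarith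

theorem SS_nonneg (n j k l : ℕ) : 0 ≤ SS n j k l := by
  unfold SS; exact Finset.sum_nonneg (fun _ _ => by positivity)

theorem choose_est (n j : ℕ) : ((n.choose j : ℝ)) * ((n : ℝ) ^ j * 2) ≤ 2 * ((n : ℝ) ^ (2 * j) / j.factorial) := by
  have := Nat.choose_le_pow_div (α := ℝ) j n
  calc _ ≤ ((n : ℝ) ^ j / j.factorial) * ((n : ℝ) ^ j * 2) := by gcongr
    _ = _ := by rw [two_mul j, pow_add]; ring

theorem SS_dom (c : ℝ) (n j : ℕ) (hn : 10 ≤ n) (hL : 0 ≤ Real.log n + c)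
    (hX : 6 * Real.exp 1 * (Real.exp (-(16 / 15 * c)) * Real.exp (-(1 / 15 * Real.log n))) ≤ 1 / 2) :
    SS n j (kk c n) (ll c n) ≤ 8 * (Real.exp (-(2 * c)) ^ j / j.factorial) + 4 * (1 / 2) ^ j := by
  have hf : (0 : ℝ) < j.factorial := by exact_mod_cast j.factorial_pos
  by_cases hj : j + 2 ≤ n
  swap
  · rw [SS_zero _ _ _ (by omega) (by omega)]; positivity
  have hp := p_est c n j hn hj
  have hp' := div_le_div_of_nonneg_right hp hf.le
  obtain ⟨h0, -⟩ := p_props n j hn hj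
  set p := (2 * ((n : ℝ) - j) - 3) / (2 * n - 3) with hpd
  have key : ∀ qb : ℝ, 0 ≤ qb → (∀ q, EigIn (VV n j) (CC (Qmeas n)) q → |q| ≤ qb) →
      SS n j (kk c n) (ll c n) ≤ 4 * ((n : ℝ) ^ (2 * j) * qb ^ (2 * kk c n) / j.factorial) +
        4 * (Real.exp (-(2 * c)) ^ j / j.factorial) := by
    intro qb hq0 hq
    refine (SS_bound1 j _ _ hj qb hq0 hq).trans ?_
    have := mul_le_mul_of_nonneg_left (choose_est n j) (show 0 ≤ 2 * (qb ^ (2 * kk c n) + p ^ (2 * ll c n)) by positivity)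
    refine this.trans ?_
    calc _ = 4 * ((n : ℝ) ^ (2 * j) * qb ^ (2 * kk c n) / j.factorial) +
        4 * ((n : ℝ) ^ (2 * j) * p ^ (2 * ll c n) / j.factorial) := by ring
      _ ≤ _ := by linarith
  rcases le_total ((j : ℝ) / (n - 1)) (1 / 3) with h | h
  · have := key _ (Real.exp_pos _).le (fun q hq => (q_final hn j hj q hq).1 h)
    have h2 := div_le_div_of_nonneg_right (q_est1 c n j hn hL) hf.le
    have : (0 : ℝ) ≤ (1 / 2) ^ j := by positivity
    linarith
  · have := key _ (Real.exp_pos _).le (fun q hq => (q_final hn j hj q hq).2 h)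
    have h2 := q_est2 c n j hn hL hX h
    have : (0 : ℝ) ≤ Real.exp (-(2 * c)) ^ j / j.factorial := by positivity
    linarith

theorem tlog : Tendsto (fun n : ℕ => Real.log n) atTop atTop :=
  Real.tendsto_log_atTop.comp tendsto_natCast_atTop_atTop

theorem ev_L (c : ℝ) : ∀ᶠ n : ℕ in atTop, 0 ≤ Real.log n + c := by
  filter_upwards [tlog.eventually_ge_atTop (-c)] with n hn
  linarith

theorem ev_X (c : ℝ) : ∀ᶠ n : ℕ in atTop,
    6 * Real.exp 1 * (Real.exp (-(16 / 15 * c)) * Real.exp (-(1 / 15 * Real.log n))) ≤ 1 / 2 := by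
  have : Tendsto (fun n : ℕ => 6 * Real.exp 1 * (Real.exp (-(16 / 15 * c)) * Real.exp (-(1 / 15 * Real.log n)))) atTop
      (nhds (6 * Real.exp 1 * (Real.exp (-(16 / 15 * c)) * 0))) := by
    refine Tendsto.const_mul _ (Tendsto.const_mul _ ?_)
    refine Real.tendsto_exp_neg_atTop_nhds_zero.comp ?_
    exact tlog.const_mul_atTop (by norm_num)
  exact this.eventually_le_const (by norm_num)

theorem final_of (c : ℝ) (hfix : ∀ j, Tendsto (fun n : ℕ => SS n j (kk c n) (ll c n)) atTop (nhds 0)) :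
    Filter.Tendsto (fun n : ℕ =>
      ((Nat.factorial n : ℝ) / 2) *
        ∑ σ : alternatingGroup (Fin n),
          (convPow (Qmeas n) (kk c n) σ -
            convPow (Pmeas n) (ll c n) σ) ^ 2)
      Filter.atTop (nhds 0) := by
  have h1 : Tendsto (fun n : ℕ => ∑' j, SS n j (kk c n) (ll c n)) atTop (nhds (∑' j : ℕ, (0 : ℝ))) := by
    refine tendsto_tsum_of_dominated_convergence
      (bound := fun j : ℕ => 8 * (Real.exp (-(2 * c)) ^ j / j.factorial) + 4 * (1 / 2) ^ j) ?_ hfix ?_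
    · exact ((Real.summable_pow_div_factorial _).mul_left _).add (summable_geometric_two.mul_left _)
    · filter_upwards [ev_L c, ev_X c, eventually_ge_atTop 10] with n h1 h2 h3 j
      rw [Real.norm_of_nonneg (SS_nonneg _ _ _ _)]
      exact SS_dom c n j h3 h1 h2
  rw [tsum_zero] at h1
  have h2 := h1.div_const 2
  rw [zero_div] at h2
  refine h2.congr' ?_
  filter_upwards [eventually_ge_atTop 10] with n hn
  rw [total_eq, tsum_eq_sum (s := Finset.range (n + 1))]
  intro j hj
  rw [Finset.mem_range] at hj
  exact SS_zero _ _ _ (by omega) (by omega)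

theorem tinv : Tendsto (fun n : ℕ => 1 / (n : ℝ)) atTop (nhds 0) := tendsto_one_div_atTop_nhds_zero_nat

theorem tLn (c : ℝ) : Tendsto (fun n : ℕ => (Real.log n + c) / n) atTop (nhds 0) := by
  have h1 : Tendsto (fun n : ℕ => Real.log n / n) atTop (nhds 0) := by
    have := Real.isLittleO_log_id_atTop.tendsto_div_nhds_zero
    exact this.comp tendsto_natCast_atTop_atTop
  have h2 := h1.add (tinv.const_mul c)
  simp only [mul_zero, add_zero] at h2
  refine h2.congr fun n => by ring

theorem lim_gen (c a : ℝ) (ha : 0 < a) (j : ℕ) (x : ℕ → ℝ) (k : ℕ → ℕ) (h : ℝ → ℝ) (hh : ContinuousAt h 0)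
    (hx : ∀ᶠ n : ℕ in atTop, x n = (1 / (n : ℝ)) * (j * a + (1 / (n : ℝ)) * h (1 / (n : ℝ))))
    (hk : Tendsto (fun n : ℕ => ((k n : ℝ) - n * (Real.log n + c) / a) / n) atTop (nhds 0)) :
    Tendsto (fun n : ℕ => (n : ℝ) ^ j * (1 - x n) ^ k n) atTop (nhds (Real.exp (-(j * c)))) := by
  have th : Tendsto (fun n : ℕ => h (1 / (n : ℝ))) atTop (nhds (h 0)) := hh.tendsto.comp tinv
  have e1 : Tendsto (fun n : ℕ => (j : ℝ) * a + (1 / (n : ℝ)) * h (1 / (n : ℝ))) atTop (nhds (j * a)) := by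
    have := (tinv.mul th).const_add ((j : ℝ) * a)
    simpa using this
  have ex : Tendsto x atTop (nhds 0) := by
    have := tinv.mul e1
    rw [zero_mul] at this
    exact this.congr' (hx.mono fun n hn => hn.symm)
  -- k x - j L
  have e2 : Tendsto (fun n : ℕ => (k n : ℝ) * x n - j * (Real.log n + c)) atTop (nhds 0) := by
    have t := (hk.mul e1).add (((tLn c).mul th).div_const a)
    simp only [zero_mul, zero_div, add_zero] at t
    refine t.congr' ?_
    filter_upwards [hx, eventually_ge_atTop 1] with n hn h1
    have h1' : (n : ℝ) ≠ 0 := by positivity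
    rw [hn]; field_simp; ring
  have e3 : Tendsto (fun n : ℕ => (k n : ℝ) * x n ^ 2) atTop (nhds 0) := by
    have t := ((hk.mul ex).mul e1).add ((((tLn c).div_const a).mul e1).mul e1)
    simp only [zero_mul, zero_div, add_zero] at t
    refine t.congr' ?_
    filter_upwards [hx, eventually_ge_atTop 1] with n hn h1
    have h1' : (n : ℝ) ≠ 0 := by positivity
    rw [hn]; field_simp; ring
  have hsm : ∀ᶠ n in atTop, |x n| < 1 / 2 := by
    have := ex.abs
    rw [abs_zero] at this
    exact this.eventually_lt_const (by norm_num)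
  have e4 : Tendsto (fun n : ℕ => (k n : ℝ) * (x n + Real.log (1 - x n))) atTop (nhds 0) := by
    have t := e3.const_mul 2
    rw [mul_zero] at t
    refine squeeze_zero_norm' ?_ t
    filter_upwards [hsm] with n hn
    have := Real.abs_log_sub_add_sum_range_le (show |x n| < 1 by linarith) 1
    simp only [Finset.range_one, Finset.sum_singleton, zero_add, pow_one, Nat.cast_zero, div_one] at this
    rw [Real.norm_eq_abs, abs_mul, Nat.abs_cast]
    have h2 : |x n| ^ (1 + 1) / (1 - |x n|) ≤ 2 * x n ^ 2 := by
      rw [div_le_iff₀ (by linarith), one_add_one_eq_two, sq_abs]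
      nlinarith [sq_nonneg (x n)]
    calc _ ≤ (k n : ℝ) * (2 * x n ^ 2) := mul_le_mul_of_nonneg_left (this.trans h2) (Nat.cast_nonneg _)
      _ = _ := by ring
  have e5 : Tendsto (fun n : ℕ => -(j * c) - ((k n : ℝ) * x n - j * (Real.log n + c)) + (k n : ℝ) * (x n + Real.log (1 - x n)))
      atTop (nhds (-(j * c))) := by
    simpa using (e2.const_sub (-(j * c))).add e4
  refine (Real.continuous_exp.continuousAt.tendsto.comp e5).congr' ?_
  filter_upwards [hsm, eventually_ge_atTop 1] with n hn h1
  have h3 : 0 < 1 - x n := by have := le_abs_self (x n); linarith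
  rw [npow_exp _ _ h1]
  conv_rhs => rw [← Real.exp_log h3]
  rw [← Real.exp_nat_mul, ← Real.exp_add]
  simp only [Function.comp]
  congr 1; ring

theorem kk_lim (c : ℝ) : Tendsto (fun n : ℕ => ((kk c n : ℝ) - n * (Real.log n + c) / 3) / n) atTop (nhds 0) := by
  refine squeeze_zero' ?_ ?_ tinv
  · refine Eventually.of_forall fun n => ?_
    have := kk_ge c n
    apply div_nonneg _ (Nat.cast_nonneg _); linarith
  · filter_upwards [ev_L c] with n hn
    have : (kk c n : ℝ) < _ := Nat.ceil_lt_add_one (show 0 ≤ ((n : ℝ) / 3) * (Real.log n + c) by positivity)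
    apply div_le_div_of_nonneg_right _ (Nat.cast_nonneg _); linarith

theorem ll_lim (c : ℝ) : Tendsto (fun n : ℕ => ((ll c n : ℝ) - n * (Real.log n + c) / 1) / n) atTop (nhds 0) := by
  have h0 : Tendsto (fun n : ℕ => ((ll c n : ℝ) - (n - 3 / 2) * (Real.log n + c)) / n) atTop (nhds 0) := by
    refine squeeze_zero' ?_ ?_ tinv
    · refine Eventually.of_forall fun n => ?_
      have := ll_ge c n
      apply div_nonneg _ (Nat.cast_nonneg _); linarith
    · filter_upwards [ev_L c, eventually_ge_atTop 10] with n hn h10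
      have hn' : (10 : ℝ) ≤ n := by exact_mod_cast h10
      have : (ll c n : ℝ) < _ := Nat.ceil_lt_add_one (show 0 ≤ ((n : ℝ) - 3 / 2) * (Real.log n + c) from mul_nonneg (by linarith) hn)
      apply div_le_div_of_nonneg_right _ (Nat.cast_nonneg _); linarith
  have := h0.sub ((tLn c).const_mul (3 / 2))
  simp only [mul_zero, sub_zero] at this
  exact this.congr fun n => by ring

theorem p_lim (c : ℝ) (j : ℕ) : Tendsto (fun n : ℕ => (n : ℝ) ^ j * (1 - 2 * j / (2 * n - 3)) ^ ll c n) atTop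
    (nhds (Real.exp (-(j * c)))) := by
  refine lim_gen c 1 one_pos j _ _ (fun u => 3 * j / (2 - 3 * u)) ?_ ?_ (ll_lim c)
  · refine ContinuousAt.div (by fun_prop) (by fun_prop) (by norm_num)
  · filter_upwards [eventually_ge_atTop 10] with n h10
    have hn' : (10 : ℝ) ≤ n := by exact_mod_cast h10
    have h1 : (2 * (n : ℝ) - 3) ≠ 0 := by linarith
    have h2 : (n : ℝ) ≠ 0 := by linarith
    have h3 : 2 - 3 * (1 / (n : ℝ)) = (2 * n - 3) / n := by field_simp
    rw [h3]; field_simp; ring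

theorem qA_lim (c : ℝ) (j : ℕ) : Tendsto (fun n : ℕ => (n : ℝ) ^ j *
    (1 - 3 * j * (n - 1 - j) / (((n : ℝ) - 1) * (n - 2))) ^ kk c n) atTop
    (nhds (Real.exp (-(j * c)))) := by
  refine lim_gen c 3 (by norm_num) j _ _ (fun u => 3 * j * ((2 - j) - 2 * u) / ((1 - u) * (1 - 2 * u))) ?_ ?_ (kk_lim c)
  · refine ContinuousAt.div (by fun_prop) (by fun_prop) (by norm_num)
  · filter_upwards [eventually_ge_atTop 10] with n h10
    have hn' : (10 : ℝ) ≤ n := by exact_mod_cast h10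
    have h1 : ((n : ℝ) - 1) ≠ 0 := by linarith
    have h1' : ((n : ℝ) - 2) ≠ 0 := by linarith
    have h2 : (n : ℝ) ≠ 0 := by linarith
    have h3 : 1 - 2 * (1 / (n : ℝ)) = (n - 2) / n := by field_simp
    have h4 : 1 - (1 / (n : ℝ)) = (n - 1) / n := by field_simp
    rw [h3, h4]; field_simp; ring

theorem qB_lim (c : ℝ) (j : ℕ) : Tendsto (fun n : ℕ => (n : ℝ) ^ j *
    (1 - (3 * j * (n - 1 - j) / (((n : ℝ) - 1) * (n - 2)) + j * (j + 1) * (2 * j + 1) / (2 * n * (n - 1) * (n - 2)))) ^ kk c n) atTop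
    (nhds (Real.exp (-(j * c)))) := by
  refine lim_gen c 3 (by norm_num) j _ _ (fun u => 3 * j * ((2 - j) - 2 * u) / ((1 - u) * (1 - 2 * u)) +
      u * (j * (j + 1) * (2 * j + 1)) / (2 * ((1 - u) * (1 - 2 * u)))) ?_ ?_ (kk_lim c)
  · refine ContinuousAt.add (ContinuousAt.div (by fun_prop) (by fun_prop) (by norm_num)) (ContinuousAt.div (by fun_prop) (by fun_prop) (by norm_num))
  · filter_upwards [eventually_ge_atTop 10] with n h10
    have hn' : (10 : ℝ) ≤ n := by exact_mod_cast h10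
    have h1 : ((n : ℝ) - 1) ≠ 0 := by linarith
    have h1' : ((n : ℝ) - 2) ≠ 0 := by linarith
    have h2 : (n : ℝ) ≠ 0 := by linarith
    have h3 : 1 - 2 * (1 / (n : ℝ)) = (n - 2) / n := by field_simp
    have h4 : 1 - (1 / (n : ℝ)) = (n - 1) / n := by field_simp
    rw [h3, h4]; field_simp; ring

theorem qB_small (j : ℕ) : ∀ᶠ n : ℕ in atTop,
    0 ≤ 1 - (3 * j * (n - 1 - j) / (((n : ℝ) - 1) * (n - 2)) + j * (j + 1) * (2 * j + 1) / (2 * n * (n - 1) * (n - 2))) := by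
  have t1 : Tendsto (fun n : ℕ => 1 / ((n : ℝ) - 2)) atTop (nhds 0) := by
    have : Tendsto (fun n : ℕ => (n : ℝ) - 2) atTop atTop :=
      tendsto_atTop_add_const_right _ (-2) tendsto_natCast_atTop_atTop
    simp only [one_div]
    exact this.inv_tendsto_atTop
  have t2 := t1.const_mul (3 * (j : ℝ) + j * (j + 1) * (2 * j + 1))
  rw [mul_zero] at t2
  filter_upwards [t2.eventually_le_const (show (0 : ℝ) < 1 by norm_num), eventually_ge_atTop 10] with n hn h10
  have hn' : (10 : ℝ) ≤ n := by exact_mod_cast h10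
  have h1 : 0 < ((n : ℝ) - 1) := by linarith
  have h1' : 0 < ((n : ℝ) - 2) := by linarith
  have h2 : 0 < (n : ℝ) := by linarith
  have hj0 : (0 : ℝ) ≤ j := Nat.cast_nonneg _
  have b1 : 3 * j * (n - 1 - j) / (((n : ℝ) - 1) * (n - 2)) ≤ 3 * j * (1 / (n - 2)) := by
    rw [mul_one_div, div_le_div_iff₀ (by positivity) h1']
    nlinarith [mul_nonneg (mul_nonneg hj0 hj0) h1'.le]
  have b2 : j * (j + 1) * (2 * j + 1) / (2 * n * ((n : ℝ) - 1) * (n - 2)) ≤ j * (j + 1) * (2 * j + 1) * (1 / (n - 2)) := by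
    rw [mul_one_div]
    apply div_le_div_of_nonneg_left (by positivity) h1'
    have : 1 ≤ 2 * n * ((n : ℝ) - 1) := by nlinarith
    nlinarith
  linarith [add_mul (3 * (j : ℝ)) (j * (j + 1) * (2 * j + 1)) (1 / ((n : ℝ) - 2))]

theorem fix_lim (c : ℝ) (j : ℕ) : Tendsto (fun n : ℕ => SS n j (kk c n) (ll c n)) atTop (nhds 0) := by
  set A : ℕ → ℝ := fun n => 1 - 3 * j * (n - 1 - j) / (((n : ℝ) - 1) * (n - 2)) with hA
  set B : ℕ → ℝ := fun n => 1 - (3 * j * (n - 1 - j) / (((n : ℝ) - 1) * (n - 2)) + j * (j + 1) * (2 * j + 1) / (2 * n * (n - 1) * (n - 2))) with hB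
  set p : ℕ → ℝ := fun n => 1 - 2 * j / (2 * n - 3) with hp
  have tA := ((qA_lim c j).sub (p_lim c j)).abs
  have tB := ((qB_lim c j).sub (p_lim c j)).abs
  rw [sub_self, abs_zero] at tA tB
  have tM := ((tA.add tB).pow 2).const_mul 4
  have tN := (tinv.const_mul (64 * Real.exp (-(2 * c)) ^ j))
  have tt := tM.add tN
  simp only [add_zero, mul_zero, ne_eq, OfNat.ofNat_ne_zero, not_false_eq_true, zero_pow] at tt
  refine squeeze_zero' (Eventually.of_forall fun n => SS_nonneg _ _ _ _) ?_ tt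
  filter_upwards [eventually_ge_atTop 10, eventually_ge_atTop (3 * j + 3), ev_L c, qB_small j] with n h10 h3j hL hB0
  have hn' : (10 : ℝ) ≤ n := by exact_mod_cast h10
  have h3j' : 3 * (j : ℝ) + 3 ≤ n := by exact_mod_cast h3j
  have hj : j + 2 ≤ n := by omega
  have hsm : (j : ℝ) / (n - 1) ≤ 1 / 3 := by
    rw [div_le_iff₀ (by linarith)]; linarith
  obtain ⟨hp0, hpe⟩ := p_props n j h10 hj
  have hpp := p_est c n j h10 hj
  have hqq := q_est1 c n j h10 hL
  set k := kk c n
  set l := ll c n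
  set M := |A n ^ k - p n ^ l| + |B n ^ k - p n ^ l| with hM
  have hM0 : 0 ≤ M := by positivity
  have key := SS_bound2 j k l hj _ M (Real.exp_pos _).le (fun q hq => (q_final h10 j hj q hq).1 hsm) hM0 (by
    intro q hq
    obtain ⟨a1, a2, -, -⟩ := q_bounds (by omega) j hj q hq
    rw [hpe]
    have hq0 : 0 ≤ q := hB0.trans a2
    have u1 : q ^ k ≤ A n ^ k := pow_le_pow_left₀ hq0 a1 k
    have u2 : B n ^ k ≤ q ^ k := pow_le_pow_left₀ hB0 a2 k
    have v1 := le_abs_self (A n ^ k - p n ^ l)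
    have v2 := neg_abs_le (B n ^ k - p n ^ l)
    have v3 := abs_nonneg (A n ^ k - p n ^ l)
    have v4 := abs_nonneg (B n ^ k - p n ^ l)
    rw [abs_le]
    constructor <;> simp only [hM, hp] at * <;> linarith)
  refine key.trans (add_le_add ?_ ?_)
  · have c1 := choose_est n j
    have hf : (1 : ℝ) ≤ j.factorial := by exact_mod_cast j.factorial_pos
    have c2 : (n : ℝ) ^ (2 * j) / j.factorial ≤ n ^ (2 * j) := div_le_self (by positivity) hf
    have c3 : |(n : ℝ) ^ j * A n ^ k - n ^ j * p n ^ l| + |(n : ℝ) ^ j * B n ^ k - n ^ j * p n ^ l| = n ^ j * M := by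
      rw [← mul_sub, ← mul_sub, abs_mul, abs_mul, abs_of_nonneg (by positivity : (0 : ℝ) ≤ (n : ℝ) ^ j), hM]; ring
    calc _ ≤ 2 * (M ^ 2 * (2 * (n : ℝ) ^ (2 * j))) := by
          apply mul_le_mul_of_nonneg_left _ (by norm_num)
          apply mul_le_mul_of_nonneg_left _ (by positivity)
          linarith
      _ = 4 * (n ^ j * M) ^ 2 := by rw [mul_pow, ← pow_mul, mul_comm j 2]; ring
      _ ≤ _ := by rw [← c3]
  · have hn0 : (0 : ℝ) ≤ 1 / n := by positivity
    have := mul_le_mul_of_nonneg_right (add_le_add hqq hpp) hn0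
    calc _ = 32 * (((n : ℝ) ^ (2 * j) * (Real.exp (-(3 * ((j : ℝ) / (n - 1))))) ^ (2 * k) +
        (n : ℝ) ^ (2 * j) * ((2 * ((n : ℝ) - j) - 3) / (2 * n - 3)) ^ (2 * l)) * (1 / n)) := by ring
      _ ≤ _ := by linarith

theorem scaled_l2_Q_vs_P (c : ℝ) :
    Filter.Tendsto (fun n : ℕ =>
      ((Nat.factorial n : ℝ) / 2) *
        ∑ σ : alternatingGroup (Fin n),
          (convPow (Qmeas n) ⌈((n : ℝ) / 3) * (Real.log n + c)⌉₊ σ -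
            convPow (Pmeas n) ⌈((n : ℝ) - 3 / 2) * (Real.log n + c)⌉₊ σ) ^ 2)
      Filter.atTop (nhds 0) :=
  final_of c (fix_lim c)
end

section
/- Let a, b, a′, b′ be nonnegative real numbers, let κ > 0, and let N₁, N₂ be positive integers. Let M₁ be the 2×2 real matrix with zero diagonal and both off-diagonal entries equal to a′+b′, and let M₂ be the 2×2 real matrix with first row (a², (a+b)/κ) and second row (0, b²). Then Tr( (M₁^{N₁} − M₂^{N₂})² ) ≤ a^{4N₂} + b^{4N₂} + 2(a′+b′)^{2N₁}. -/
theorem aux_pow_one (s : ℝ) (hs : 0 ≤ s) (n : ℕ) : ∃ p q : ℝ, 0 ≤ p ∧ 0 ≤ q ∧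
    p ^ 2 + q ^ 2 = s ^ (2 * n) ∧
    (!![0, s; s, 0] : Matrix (Fin 2) (Fin 2) ℝ) ^ n = !![p, q; q, p] := by
  induction n with
  | zero => exact ⟨1, 0, by norm_num, le_refl _, by norm_num, by rw [pow_zero, Matrix.one_fin_two]⟩
  | succ k ih =>
    obtain ⟨p, q, hp, hq, h, hM⟩ := ih
    refine ⟨q * s, p * s, by positivity, by positivity, ?_, ?_⟩
    · rw [mul_add, pow_add, ← h]; ring
    · rw [pow_succ, hM, Matrix.mul_fin_two]; simp

theorem aux_pow_two (x y d : ℝ) (hx : 0 ≤ x) (hy : 0 ≤ y) (hd : 0 ≤ d) (n : ℕ) :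
    ∃ c : ℝ, 0 ≤ c ∧
    (!![x, d; 0, y] : Matrix (Fin 2) (Fin 2) ℝ) ^ n = !![x ^ n, c; 0, y ^ n] := by
  induction n with
  | zero => exact ⟨0, le_refl _, by simp [Matrix.one_fin_two]⟩
  | succ k ih =>
    obtain ⟨c, hc, hM⟩ := ih
    refine ⟨x ^ k * d + c * y, by positivity, ?_⟩
    rw [pow_succ, hM, Matrix.mul_fin_two]; simp [pow_succ]

theorem trace_sq_diff_le (a b a' b' κ : ℝ) (ha : 0 ≤ a) (hb : 0 ≤ b)
    (ha' : 0 ≤ a') (hb' : 0 ≤ b') (hκ : 0 < κ) (N₁ N₂ : ℕ) (hN₁ : 0 < N₁) (hN₂ : 0 < N₂) :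
    Matrix.trace
        (((!![0, a' + b'; a' + b', 0] : Matrix (Fin 2) (Fin 2) ℝ) ^ N₁ -
          (!![a ^ 2, (a + b) / κ; 0, b ^ 2] : Matrix (Fin 2) (Fin 2) ℝ) ^ N₂) ^ 2) ≤
      a ^ (4 * N₂) + b ^ (4 * N₂) + 2 * (a' + b') ^ (2 * N₁) := by
  obtain ⟨p, q, hp, hq, h, hM⟩ := aux_pow_one (a' + b') (by positivity) N₁
  obtain ⟨c, hc, hM'⟩ := aux_pow_two (a ^ 2) (b ^ 2) ((a + b) / κ) (by positivity)
    (by positivity) (by positivity) N₂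
  rw [hM, hM', ← h]
  have hA : a ^ (4 * N₂) = ((a ^ 2) ^ N₂) ^ 2 := by rw [← pow_mul, ← pow_mul]; congr 1; ring
  have hB : b ^ (4 * N₂) = ((b ^ 2) ^ N₂) ^ 2 := by rw [← pow_mul, ← pow_mul]; congr 1; ring
  rw [hA, hB]
  have h1 : 0 ≤ (a ^ 2) ^ N₂ := by positivity
  have h2 : 0 ≤ (b ^ 2) ^ N₂ := by positivity
  generalize (a ^ 2) ^ N₂ = A at *
  generalize (b ^ 2) ^ N₂ = B at *
  rw [pow_two, Matrix.trace_fin_two]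
  simp only [Matrix.mul_apply, Fin.sum_univ_two, Matrix.sub_apply, Matrix.of_apply,
    Matrix.cons_val_zero, Matrix.cons_val_one, Matrix.cons_val']
  simp
  nlinarith [mul_nonneg hp h1, mul_nonneg hp h2, mul_nonneg hq hc]
end

section
/- Let n ≥ 3 and let J_n = Σ_{i=1}^{n−1} (1,2)·(i,n) be the n-th Young–Jucys–Murphy element of the alternating group, an element of the group algebra of S_n supported on even permutations. Then J_n² = (n−1)·id + Σ_{1≤i<j≤n−1} ( (i,j,n) + (j,i,n) ); that is, J_n² equals the element P′_n = (n−1)·id + Σ_{1≤i<j≤n−1} ((i,j,n)+(j,i,n)). -/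
/-- The 3-cycle `(a, b, c)` sending `a ↦ b ↦ c ↦ a`. -/
def cyc3 {n : ℕ} (a b c : Fin n) : Equiv.Perm (Fin n) :=
  Equiv.swap a c * Equiv.swap a b

theorem cyc3_eq_aux {n : ℕ} (a b c : Fin n) (hab : a ≠ b) (hac : a ≠ c) (hbc : b ≠ c) :
    cyc3 a b c = Equiv.swap b c * Equiv.swap a c := by
  ext x
  simp only [cyc3, Equiv.Perm.mul_apply, Equiv.swap_apply_def]
  grind

theorem sum_prod_aux {n : ℕ} {M : Type*} [AddCommMonoid M] (S : Finset (Fin n))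
    (f : Fin n → Fin n → M) :
    ∑ i ∈ S, ∑ j ∈ S, f i j = ∑ i ∈ S, f i i +
      ∑ p ∈ (S ×ˢ S).filter (fun p => p.1 < p.2), (f p.2 p.1 + f p.1 p.2) := by
  rw [Finset.sum_add_distrib]
  have h : ∑ p ∈ (S ×ˢ S).filter (fun p => p.1 < p.2), f p.2 p.1 =
      ∑ p ∈ (S ×ˢ S).filter (fun p => p.2 < p.1), f p.1 p.2 := by
    apply Finset.sum_equiv (Equiv.prodComm _ _)
    · intro p
      simp [and_comm]
    · intro p _
      rfl
  have h1 : ∑ i ∈ S, f i i = ∑ i ∈ S, ∑ j ∈ S, if i = j then f i j else 0 := by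
    apply Finset.sum_congr rfl
    intro i hi
    rw [Finset.sum_ite_eq]
    simp [hi]
  rw [h, h1, Finset.sum_filter, Finset.sum_filter, Finset.sum_product, Finset.sum_product,
    ← Finset.sum_add_distrib, ← Finset.sum_add_distrib]
  apply Finset.sum_congr rfl
  intro i _
  rw [← Finset.sum_add_distrib, ← Finset.sum_add_distrib]
  apply Finset.sum_congr rfl
  intro j _
  rcases lt_trichotomy i j with h | h | h
  · simp [h, h.ne, h.not_gt]
  · simp [h]
  · simp [h, h.ne', h.not_gt]

theorem conj_aux {n : ℕ} (S : Finset (Fin n)) (s : Equiv.Perm (Fin n)) (c : Fin n)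
    (hs : s * s = 1) (hS : ∀ i, i ∈ S ↔ s i ∈ S) (hc : s c = c) :
    (∑ i ∈ S, MonoidAlgebra.of ℂ (Equiv.Perm (Fin n)) (s * Equiv.swap i c)) ^ 2 =
    ∑ i ∈ S, ∑ j ∈ S,
      MonoidAlgebra.of ℂ (Equiv.Perm (Fin n)) (Equiv.swap i c * Equiv.swap j c) := by
  have h : ∑ i ∈ S, MonoidAlgebra.of ℂ (Equiv.Perm (Fin n)) (s * Equiv.swap i c) =
      ∑ i ∈ S, MonoidAlgebra.of ℂ (Equiv.Perm (Fin n)) (Equiv.swap i c * s) := by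
    apply Finset.sum_equiv s hS
    intro i _
    rw [Equiv.mul_swap_eq_swap_mul, hc]
  rw [pow_two]
  nth_rewrite 1 [h]
  rw [Finset.sum_mul_sum]
  refine Finset.sum_congr rfl fun i _ => Finset.sum_congr rfl fun j _ => ?_
  rw [← map_mul]
  congr 1
  rw [mul_assoc, ← mul_assoc s, hs, one_mul]


/-- `J_n² = (n-1)·id + Σ_{1 ≤ i < j ≤ n-1} ((i,j,n) + (j,i,n))` in `ℂ[S_n]`, where
`J_n = Σ_{i=1}^{n-1} (1,2)·(i,n)` is the `n`-th YJM element of the alternating group.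
Points `1, …, n` are labelled by `0, …, n-1 : Fin n`. -/
theorem yjm_squared (n : ℕ) (hn : 3 ≤ n) :
    (∑ i ∈ Finset.univ.filter (fun i : Fin n => (i : ℕ) ≤ n - 2),
        MonoidAlgebra.of ℂ (Equiv.Perm (Fin n))
          (Equiv.swap ⟨0, by omega⟩ ⟨1, by omega⟩ * Equiv.swap i ⟨n - 1, by omega⟩)) ^ 2 =
      ((n : ℂ) - 1) • (1 : MonoidAlgebra ℂ (Equiv.Perm (Fin n))) +
        ∑ p ∈ Finset.univ.filter
            (fun p : Fin n × Fin n => p.1 < p.2 ∧ (p.2 : ℕ) ≤ n - 2),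
          (MonoidAlgebra.of ℂ (Equiv.Perm (Fin n)) (cyc3 p.1 p.2 ⟨n - 1, by omega⟩) +
           MonoidAlgebra.of ℂ (Equiv.Perm (Fin n)) (cyc3 p.2 p.1 ⟨n - 1, by omega⟩)) := by
  have hlt : ∀ i : Fin n, (i : ℕ) ≤ n - 2 ↔ i ≠ ⟨n - 1, by omega⟩ := by
    intro i
    rw [Ne, Fin.ext_iff]
    have := i.2
    simp only
    omega
  have hc : Equiv.swap (⟨0, by omega⟩ : Fin n) ⟨1, by omega⟩ ⟨n - 1, by omega⟩
      = ⟨n - 1, by omega⟩ := by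
    apply Equiv.swap_apply_of_ne_of_ne
    · rw [Ne, Fin.ext_iff]
      simp only
      omega
    · rw [Ne, Fin.ext_iff]
      simp only
      omega
  rw [conj_aux _ _ _ (Equiv.swap_mul_self _ _) _ hc, sum_prod_aux]
  · congr 1
    · simp only [Equiv.swap_mul_self, map_one, Finset.sum_const, hlt]
      rw [Finset.filter_ne', Finset.card_erase_of_mem (Finset.mem_univ _), Finset.card_univ,
        Fintype.card_fin, ← Nat.cast_smul_eq_nsmul ℂ, Nat.cast_sub (by omega), Nat.cast_one]
    · apply Finset.sum_congr
      · ext p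
        simp only [Finset.mem_filter, Finset.mem_product, Finset.mem_univ, true_and,
          Fin.lt_def]
        omega
      · intro p hp
        simp only [Finset.mem_filter, Finset.mem_univ, true_and] at hp
        obtain ⟨h1, h2⟩ := hp
        have h3 : (p.1 : ℕ) ≤ n - 2 := by
          rw [Fin.lt_def] at h1
          omega
        rw [cyc3_eq_aux _ _ _ h1.ne ((hlt _).1 h3) ((hlt _).1 h2),
          cyc3_eq_aux _ _ _ h1.ne' ((hlt _).1 h2) ((hlt _).1 h3)]
  · intro i
    simp only [Finset.mem_filter, Finset.mem_univ, true_and, hlt]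
    refine not_congr ⟨fun h => by rw [h, hc], fun h => ?_⟩
    exact (Equiv.swap _ _).injective (h.trans hc.symm)
end

section
/- For every n ≥ 4, the group-algebra elements P_n = id + Σ_{i=1}^{n−2} ((i,n−1,n) + (i,n,n−1)) and P′_n = (n−1)·id + Σ_{1≤i<j≤n−1} ((i,j,n) + (j,i,n)) do not commute: P_n · P′_n ≠ P′_n · P_n. -/
/-- `P_n = id + Σ_{i=1}^{n-2} ((i,n-1,n) + (i,n,n-1))` as an element of `ℂ[S_n]`.
Points `1, …, n` are labelled by `0, …, n-1 : Fin n`. -/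
noncomputable def Pelt (n : ℕ) (hn : 4 ≤ n) : MonoidAlgebra ℂ (Equiv.Perm (Fin n)) :=
  1 + ∑ i ∈ Finset.univ.filter (fun i : Fin n => (i : ℕ) ≤ n - 3),
      (MonoidAlgebra.of ℂ (Equiv.Perm (Fin n)) (cyc3 i ⟨n - 2, by omega⟩ ⟨n - 1, by omega⟩) +
       MonoidAlgebra.of ℂ (Equiv.Perm (Fin n)) (cyc3 i ⟨n - 1, by omega⟩ ⟨n - 2, by omega⟩))

/-- `P′_n = (n-1)·id + Σ_{1 ≤ i < j ≤ n-1} ((i,j,n) + (j,i,n))` as an element of `ℂ[S_n]`. -/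
noncomputable def P'elt (n : ℕ) (hn : 4 ≤ n) : MonoidAlgebra ℂ (Equiv.Perm (Fin n)) :=
  ((n : ℂ) - 1) • 1 +
    ∑ p ∈ Finset.univ.filter (fun p : Fin n × Fin n => p.1 < p.2 ∧ (p.2 : ℕ) ≤ n - 2),
      (MonoidAlgebra.of ℂ (Equiv.Perm (Fin n)) (cyc3 p.1 p.2 ⟨n - 1, by omega⟩) +
       MonoidAlgebra.of ℂ (Equiv.Perm (Fin n)) (cyc3 p.2 p.1 ⟨n - 1, by omega⟩))

/-- permutation representation on functions -/
noncomputable def permRho (n : ℕ) :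
    MonoidAlgebra ℂ (Equiv.Perm (Fin n)) →ₐ[ℂ] Module.End ℂ (Fin n → ℂ) :=
  MonoidAlgebra.lift ℂ (Module.End ℂ (Fin n → ℂ)) (Equiv.Perm (Fin n))
    { toFun := fun g => LinearMap.funLeft ℂ ℂ (g⁻¹ : Equiv.Perm (Fin n))
      map_one' := by ext; simp [LinearMap.funLeft_apply]
      map_mul' := by intro a b; ext; simp [LinearMap.funLeft_apply] }

theorem permRho_of (n : ℕ) (g : Equiv.Perm (Fin n)) (f : Fin n → ℂ) (y : Fin n) :
    permRho n (MonoidAlgebra.of ℂ _ g) f y = f (g⁻¹ y) := by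
  simp only [permRho, MonoidAlgebra.lift_of]
  rfl

theorem permRho_of_single (n : ℕ) (g : Equiv.Perm (Fin n)) (u y : Fin n) :
    permRho n (MonoidAlgebra.of ℂ _ g) (Pi.single u 1) y = if g u = y then 1 else 0 := by
  rw [permRho_of, Pi.single_apply]
  have h : g⁻¹ y = u ↔ g u = y := by
    rw [Equiv.Perm.inv_eq_iff_eq, eq_comm]
  simp only [h]

theorem permRho_one (n : ℕ) (A : MonoidAlgebra ℂ (Equiv.Perm (Fin n))) (y y' : Fin n) :
    permRho n A 1 y = permRho n A 1 y' := by
  induction A using MonoidAlgebra.induction_on with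
  | of g => simp only [permRho_of, Pi.one_apply]
  | add a b ha hb => simp only [map_add, LinearMap.add_apply, Pi.add_apply, ha, hb]
  | smul r a ha => simp only [map_smul, LinearMap.smul_apply, Pi.smul_apply, ha]

theorem cyc3_apply {n : ℕ} (a b c u : Fin n) (hab : a ≠ b) (hac : a ≠ c) (hbc : b ≠ c) :
    cyc3 a b c u = if u = a then b else if u = b then c else if u = c then a else u := by
  simp only [cyc3, Equiv.Perm.mul_apply, Equiv.swap_apply_def]
  grind

theorem rhoP (n : ℕ) (hn : 4 ≤ n) (x z : Fin n) (hx : (x : ℕ) = n - 2) (hz : (z : ℕ) = n - 1)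
    (y : Fin n) :
    permRho n (Pelt n hn) (Pi.single z 1) y = 1 + ((n : ℂ) - 3) * (if y = x then 1 else 0) := by
  have hx' : (⟨n - 2, by omega⟩ : Fin n) = x := Fin.ext hx.symm
  have hz' : (⟨n - 1, by omega⟩ : Fin n) = z := Fin.ext hz.symm
  have hxz : x ≠ z := by intro h; subst h; omega
  have hf : (Finset.univ.filter (fun i : Fin n => (i : ℕ) ≤ n - 3)) = {x, z}ᶜ := by
    ext i
    simp [Fin.ext_iff]
    omega
  have hcard : (({x, z}ᶜ : Finset (Fin n)).card : ℂ) = n - 2 := by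
    rw [Finset.card_compl, Finset.card_pair hxz, Fintype.card_fin, Nat.cast_sub (by omega)]
    simp
  unfold Pelt
  simp only [hx', hz', hf, map_add, map_sum, map_one, LinearMap.add_apply, LinearMap.sum_apply,
    Pi.add_apply, Finset.sum_apply, permRho_of_single, Module.End.one_apply]
  have : ∀ i ∈ ({x, z}ᶜ : Finset (Fin n)),
      (((if cyc3 i x z z = y then 1 else 0) + (if cyc3 i z x z = y then 1 else 0) : ℂ))
       = (if i = y then 1 else 0) + (if x = y then 1 else 0) := by
    intro i hi
    simp at hi
    rw [cyc3_apply _ _ _ _ hi.1 hi.2 hxz, cyc3_apply _ _ _ _ hi.2 hi.1 hxz.symm]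
    grind
  rw [Finset.sum_congr rfl this, Finset.sum_add_distrib, Finset.sum_const, nsmul_eq_mul, hcard,
    Finset.sum_ite_eq']
  simp only [Finset.mem_compl, Finset.mem_insert, Finset.mem_singleton, Pi.single_apply]
  by_cases h1 : y = x
  · subst h1; simp [hxz]; ring
  · by_cases h2 : y = z
    · subst h2; simp [hxz, hxz.symm]
    · simp [h1, h2, Ne.symm h1]

theorem sum_pairs (n : ℕ) (hn : 4 ≤ n) (z : Fin n) (hz : (z : ℕ) = n - 1)
    (F : Fin n → Fin n → ℂ) :
    ∑ p ∈ Finset.univ.filter (fun p : Fin n × Fin n => p.1 < p.2 ∧ (p.2 : ℕ) ≤ n - 2),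
      (F p.1 p.2 + F p.2 p.1) =
    ∑ i, ∑ j, if i ≠ j ∧ i ≠ z ∧ j ≠ z then F i j else 0 := by
  rw [Finset.sum_filter, Fintype.sum_prod_type]
  have : ∀ i j : Fin n, (if i ≠ j ∧ i ≠ z ∧ j ≠ z then F i j else 0)
     = (if i < j ∧ (j : ℕ) ≤ n - 2 then F i j else 0)
      + (if j < i ∧ (i : ℕ) ≤ n - 2 then F i j else 0) := by
    intro i j
    have := i.2
    have := j.2
    simp only [ne_eq, Fin.ext_iff, Fin.lt_def]
    split_ifs <;> first | omega | simp
  simp only [this, Finset.sum_add_distrib]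
  rw [Finset.sum_comm (f := fun i j : Fin n => if j < i ∧ (i : ℕ) ≤ n - 2 then F i j else 0)]
  simp only [← Finset.sum_add_distrib]
  refine Finset.sum_congr rfl fun i _ => Finset.sum_congr rfl fun j _ => ?_
  split_ifs <;> simp

theorem rhoP' (n : ℕ) (hn : 4 ≤ n) (z : Fin n) (hz : (z : ℕ) = n - 1) (u y : Fin n) :
    permRho n (P'elt n hn) (Pi.single u 1) y = ((n : ℂ) - 1) * (if y = u then 1 else 0) +
      ∑ i, ∑ j, if i ≠ j ∧ i ≠ z ∧ j ≠ z then
        (if (if u = i then j else if u = j then z else if u = z then i else u) = y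
          then 1 else 0) else 0 := by
  have hz' : (⟨n - 1, by omega⟩ : Fin n) = z := Fin.ext hz.symm
  unfold P'elt
  simp only [hz', map_add, map_sum, map_smul, map_one, LinearMap.add_apply, LinearMap.sum_apply,
    Pi.add_apply, Finset.sum_apply, permRho_of_single, Module.End.one_apply, LinearMap.smul_apply,
    Pi.smul_apply, smul_eq_mul]
  rw [sum_pairs n hn z hz (fun i j => if cyc3 i j z u = y then 1 else 0), Pi.single_apply]
  congr 1
  refine Finset.sum_congr rfl fun i _ => Finset.sum_congr rfl fun j _ => ?_
  split_ifs with h <;> first | rfl | (rw [cyc3_apply _ _ _ _ h.1 h.2.1 h.2.2] at *; grind)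

theorem sum_ne2 (n : ℕ) (hn : 4 ≤ n) (a b : Fin n) (h : a ≠ b) :
    (∑ j : Fin n, if j ≠ a ∧ j ≠ b then (1 : ℂ) else 0) = n - 2 := by
  have hf : (Finset.univ.filter (fun j : Fin n => j ≠ a ∧ j ≠ b)) = {a, b}ᶜ := by
    ext i
    simp
  rw [Finset.sum_boole, hf, Finset.card_compl, Finset.card_pair h, Fintype.card_fin,
    Nat.cast_sub (by omega)]
  simp

theorem rhoP'_z (n : ℕ) (hn : 4 ≤ n) (z : Fin n) (hz : (z : ℕ) = n - 1) (y : Fin n) :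
    permRho n (P'elt n hn) (Pi.single z 1) y = ((n : ℂ) - 2) + (if y = z then 1 else 0) := by
  rw [rhoP' n hn z hz]
  have : ∀ i j : Fin n, (if i ≠ j ∧ i ≠ z ∧ j ≠ z then
        (if (if z = i then j else if z = j then z else if z = z then i else z) = y
          then (1 : ℂ) else 0) else 0) =
      if i = y then (if y = z then 0 else if j ≠ y ∧ j ≠ z then 1 else 0) else 0 := by
    intro i j
    grind
  rw [Finset.sum_congr rfl fun i _ => Finset.sum_congr rfl fun j _ => this i j]
  rw [Finset.sum_comm]
  simp only [Finset.sum_ite_eq', Finset.mem_univ, if_true]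
  by_cases h : y = z
  · simp [h]; ring
  · simp only [h, if_false]
    rw [sum_ne2 n hn y z h]
    ring

theorem rhoP'_x_z (n : ℕ) (hn : 4 ≤ n) (x z : Fin n) (hz : (z : ℕ) = n - 1) (hxz : x ≠ z) :
    permRho n (P'elt n hn) (Pi.single x 1) z = ((n : ℂ) - 2) := by
  rw [rhoP' n hn z hz]
  have : ∀ i j : Fin n, (if i ≠ j ∧ i ≠ z ∧ j ≠ z then
        (if (if x = i then j else if x = j then z else if x = z then i else x) = z
          then (1 : ℂ) else 0) else 0) =
      if j = x then (if i ≠ x ∧ i ≠ z then 1 else 0) else 0 := by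
    intro i j
    grind
  simp only [this]
  simp only [Finset.sum_ite_eq', Finset.mem_univ, if_true]
  rw [sum_ne2 n hn x z hxz]
  simp [hxz.symm]

theorem rhoP'_x_y (n : ℕ) (hn : 4 ≤ n) (x y z : Fin n) (hz : (z : ℕ) = n - 1) (hxz : x ≠ z)
    (hyx : y ≠ x) (hyz : y ≠ z) :
    permRho n (P'elt n hn) (Pi.single x 1) y = 1 := by
  rw [rhoP' n hn z hz]
  have : ∀ i j : Fin n, (if i ≠ j ∧ i ≠ z ∧ j ≠ z then
        (if (if x = i then j else if x = j then z else if x = z then i else x) = y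
          then (1 : ℂ) else 0) else 0) =
      if j = y then (if i = x then 1 else 0) else 0 := by
    intro i j
    grind
  simp only [this]
  simp [hyx]

theorem Pelt_P'elt_not_commute (n : ℕ) (hn : 4 ≤ n) :
    Pelt n hn * P'elt n hn ≠ P'elt n hn * Pelt n hn := by
  intro h
  obtain ⟨x, hx⟩ : ∃ x : Fin n, (x : ℕ) = n - 2 := ⟨⟨n - 2, by omega⟩, rfl⟩
  obtain ⟨z, hz⟩ : ∃ z : Fin n, (z : ℕ) = n - 1 := ⟨⟨n - 1, by omega⟩, rfl⟩
  obtain ⟨y, hy⟩ : ∃ y : Fin n, (y : ℕ) = 0 := ⟨⟨0, by omega⟩, rfl⟩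
  have hxz : x ≠ z := by intro h; subst h; omega
  have hyx : y ≠ x := by intro h; subst h; omega
  have hyz : y ≠ z := by intro h; subst h; omega
  have e1 : permRho n (Pelt n hn) (Pi.single z 1) = 1 + ((n : ℂ) - 3) • Pi.single x 1 := by
    ext w
    rw [rhoP n hn x z hx hz]
    simp [Pi.single_apply]
  have e2 : permRho n (P'elt n hn) (Pi.single z 1) = ((n : ℂ) - 2) • 1 + Pi.single z 1 := by
    ext w
    rw [rhoP'_z n hn z hz]
    simp [Pi.single_apply]
  have h2 := congrArg (fun A => permRho n A (Pi.single z 1)) h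
  simp only [map_mul, Module.End.mul_apply, e1, e2, map_add, map_smul] at h2
  have hA := congrFun h2 y
  have hB := congrFun h2 z
  simp only [Pi.add_apply, Pi.smul_apply, smul_eq_mul, Pi.one_apply,
    rhoP'_x_z n hn x z hz hxz, rhoP'_x_y n hn x y z hz hxz hyx hyz, Pi.single_eq_of_ne hyx,
    Pi.single_eq_of_ne hxz.symm,
    permRho_one n _ y z] at hA hB
  have h3 : ((n : ℂ) - 3) * ((n : ℂ) - 3) = 0 := by linear_combination hA - hB
  have h4 : (n : ℂ) = (3 : ℕ) := by
    have := mul_self_eq_zero.mp h3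
    push_cast
    linear_combination this
  have := Nat.cast_injective h4
  omega
end
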